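/- Lieb-Thirring inequality for ideal anyons: there exists a constant C > 0 such that for every α ∈ [0,2], every N ≥ 1 and every L²-normalized antisymmetric Ψ_N ∈ L²_asym(ℝ^{2N}) (smooth, compactly supported and vanishing on the diagonals suffices), one has Σ_{j=1}^N ∫_{ℝ^{2N}} |D_{x_j} Ψ_N|² dx_1⋯dx_N ≥ C·|1 − α|·∫_{ℝ²} ρ_{Ψ_N}(x)² dx. -/

import Mathlib

open MeasureTheory

noncomputable section

abbrev E2 : Type := EuclideanSpace ℝ (Fin 2)

/-- The 90° rotation `(x¹,x²)^⊥ := (−x²,x¹)`. -/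
def perp (x : E2) : E2 := (WithLp.equiv 2 (Fin 2 → ℝ)).symm ![-(x 1), x 0]

/-- Regularized norm `|x|_R := max(|x|, R)`. -/
def regNorm (R : ℝ) (x : E2) : ℝ := max ‖x‖ R

def basisVec (c : Fin 2) : E2 := EuclideanSpace.single c 1

/-- The direction in `N`-particle configuration space corresponding to moving
particle `j` in coordinate direction `c`. -/
def dirv (N : ℕ) (j : Fin N) (c : Fin 2) : Fin N → E2 :=
  Function.update (0 : Fin N → E2) j (basisVec c)

/-- Antisymmetry of an `N`-particle wave function. -/
def Antisym (N : ℕ) (Ψ : (Fin N → E2) → ℂ) : Prop :=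
  ∀ σ : Equiv.Perm (Fin N), ∀ X : Fin N → E2,
    Ψ (X ∘ σ) = ((Equiv.Perm.sign σ : ℤ) : ℂ) * Ψ X

/-- One-particle density `ρ_Ψ`. -/
def density (N : ℕ) (Ψ : (Fin N → E2) → ℂ) (x : E2) : ℝ :=
  ∑ j : Fin N, ∫ Y : {k : Fin N // k ≠ j} → E2,
    ‖Ψ (fun k => if h : k = j then x else Y ⟨k, h⟩)‖ ^ 2

/-- Component `c` of `∇_{x_j} |Ψ|` at configuration `X`. -/
def gradAbs {N : ℕ} (Ψ : (Fin N → E2) → ℂ) (j : Fin N) (X : Fin N → E2) (c : Fin 2) : ℝ :=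
  fderiv ℝ (fun Z => ‖Ψ Z‖) X (dirv N j c)

/-- The axis-parallel closed square with lower-left corner `a` and side length `L`. -/
def square (a : E2) (L : ℝ) : Set E2 := {x | ∀ i : Fin 2, x i ∈ Set.Icc (a i) (a i + L)}

/-- Ideal (point-flux) anyon vector potential felt by particle `j`. -/
def AvecIdeal {N : ℕ} (X : Fin N → E2) (j : Fin N) : E2 :=
  ∑ k ∈ Finset.univ.erase j, (‖X j - X k‖ ^ 2)⁻¹ • perp (X j - X k)

/-- Component `c` of the ideal anyon covariant derivative `D_{x_j} Ψ`. -/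
def covDIdeal (α : ℝ) {N : ℕ} (Ψ : (Fin N → E2) → ℂ) (j : Fin N) (X : Fin N → E2)
    (c : Fin 2) : ℂ :=
  -Complex.I * fderiv ℝ Ψ X (dirv N j c) + ((α * AvecIdeal X j c : ℝ) : ℂ) * Ψ X

/-- Cauchy-Schwarz against the constant function. -/
lemma lt_cs (S : Set ℝ) (f : ℝ → ENNReal) (hf : Measurable f) :
    (∫⁻ x in S, f x) ^ 2 ≤ volume S * ∫⁻ x in S, f x ^ 2 := by
  have h := ENNReal.lintegral_mul_le_Lp_mul_Lq (volume.restrict S) (p := 2) (q := 2)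
    (by constructor <;> norm_num) (f := fun _ => 1) (g := f) (by fun_prop) hf.aemeasurable
  simp only [Pi.mul_apply, one_mul, ENNReal.one_rpow, lintegral_const, Measure.restrict_apply MeasurableSet.univ,
    Set.univ_inter] at h
  calc _ ≤ (volume S ^ (1 / 2 : ℝ) * (∫⁻ x in S, f x ^ (2:ℝ)) ^ (1 / 2 : ℝ)) ^ 2 := by gcongr
    _ = _ := by
      rw [mul_pow, ← ENNReal.rpow_natCast, ← ENNReal.rpow_mul, ← ENNReal.rpow_natCast, ← ENNReal.rpow_mul]
      norm_num

lemma lt_phase (α : ℝ) (hα : α ∈ Set.Icc (0 : ℝ) 2) :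
    2 * |1 - α| ≤ ‖1 + Complex.exp (Complex.I * α * Real.pi)‖ := by
  have hre : ‖1 + Complex.exp (Complex.I * α * Real.pi)‖ ^ 2 = (2 * Real.cos (α * Real.pi / 2)) ^ 2 := by
    have h1 : Complex.I * α * Real.pi = ((α * Real.pi : ℝ) : ℂ) * Complex.I := by push_cast; ring
    rw [h1, ← Complex.normSq_eq_norm_sq, Complex.normSq_apply]
    simp only [Complex.add_re, Complex.one_re, Complex.exp_ofReal_mul_I_re, Complex.add_im, Complex.one_im,
      Complex.exp_ofReal_mul_I_im, zero_add]
    have h2 : Real.cos (α * Real.pi) = 2 * Real.cos (α * Real.pi / 2) ^ 2 - 1 := by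
      rw [← Real.cos_two_mul]; congr 1; ring
    have := Real.sin_sq_add_cos_sq (α * Real.pi)
    nlinarith
  have key : |1 - α| ≤ |Real.cos (α * Real.pi / 2)| := by
    have h3 : Real.cos (α * Real.pi / 2) = Real.sin (Real.pi / 2 * (1 - α)) := by
      rw [← Real.cos_pi_div_two_sub]; congr 1; ring
    have hb : |1 - α| ≤ 1 := by rw [abs_le]; constructor <;> linarith [hα.1, hα.2]
    have h4 : |Real.sin (Real.pi / 2 * (1 - α))| = Real.sin (Real.pi / 2 * |1 - α|) := by
      rcases le_total 0 (1 - α) with h | h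
      · rw [abs_of_nonneg h, abs_of_nonneg]
        apply Real.sin_nonneg_of_nonneg_of_le_pi (by positivity)
        rw [abs_of_nonneg h] at hb
        nlinarith [Real.pi_pos]
      · rw [abs_of_nonpos h]
        rw [abs_of_nonpos h] at hb
        rw [mul_neg, Real.sin_neg, abs_of_nonpos]
        rw [← neg_nonneg, ← Real.sin_neg]
        apply Real.sin_nonneg_of_nonneg_of_le_pi
        · nlinarith [Real.pi_pos]
        · nlinarith [Real.pi_pos]
    rw [h3, h4]
    have := Real.mul_le_sin (x := Real.pi / 2 * |1 - α|) (by positivity) (by nlinarith [Real.pi_pos])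
    have h5 : 2 / Real.pi * (Real.pi / 2 * |1 - α|) = |1 - α| := by field_simp
    linarith
  have h6 : 0 ≤ ‖1 + Complex.exp (Complex.I * α * Real.pi)‖ := norm_nonneg _
  apply le_of_sq_le_sq _ h6
  rw [hre, mul_pow, mul_pow, ← sq_abs (Real.cos _)]
  gcongr

/-- Angular inequality. -/
lemma lt_angular (α : ℝ) (hα : α ∈ Set.Icc (0 : ℝ) 2) (u w : ℝ → ℂ) (χ : ℝ → ℝ)
    (hu : ContDiff ℝ 1 u) (hχ : ContDiff ℝ 1 χ)
    (hw : ∀ φ, deriv u φ = Complex.I * w φ - Complex.I * α * deriv χ φ * u φ)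
    (hper : ∀ φ, χ (φ + Real.pi) = χ φ + Real.pi)
    (hanti : ∀ φ, u (φ + Real.pi) = - u φ) :
    ENNReal.ofReal (|1 - α| ^ 2) * ∫⁻ φ in Set.Ioo (-Real.pi) Real.pi, ‖u φ‖ₑ ^ 2
      ≤ ENNReal.ofReal 5 * ∫⁻ φ in Set.Ioo (-Real.pi) Real.pi, ‖w φ‖ₑ ^ 2 := by
  set v : ℝ → ℂ := fun φ => u φ * Complex.exp (Complex.I * α * (χ φ : ℂ)) with hv
  have hχc : ContDiff ℝ 1 (fun φ => (χ φ : ℂ)) := Complex.ofRealCLM.contDiff.comp hχ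
  have hvc : ContDiff ℝ 1 v := by
    apply hu.mul
    exact (contDiff_const.mul hχc).cexp
  have hderiv : ∀ φ, ‖deriv v φ‖ₑ = ‖w φ‖ₑ := by
    intro φ
    have h1 : HasDerivAt u (deriv u φ) φ := (hu.differentiable one_ne_zero φ).hasDerivAt
    have h2 : HasDerivAt (fun φ => (χ φ : ℂ)) ((deriv χ φ : ℝ) : ℂ) φ :=
      ((hχ.differentiable one_ne_zero φ).hasDerivAt).ofReal_comp
    have h3 := h1.mul ((h2.const_mul (Complex.I * α)).cexp)
    have h4 : deriv v φ = Complex.I * w φ * Complex.exp (Complex.I * α * (χ φ : ℂ)) := by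
      rw [show v = u * fun φ => Complex.exp (Complex.I * α * (χ φ : ℂ)) from rfl, h3.deriv, hw φ]
      ring
    rw [h4]
    have h5 : Complex.I * α * (χ φ : ℂ) = ((α * χ φ : ℝ) : ℂ) * Complex.I := by push_cast; ring
    rw [h5, enorm_mul, enorm_mul]
    have : ‖Complex.exp (((α * χ φ : ℝ) : ℂ) * Complex.I)‖ₑ = 1 := by
      rw [← ofReal_norm, Complex.norm_exp_ofReal_mul_I]; simp
    rw [this]
    have : ‖Complex.I‖ₑ = 1 := by rw [← ofReal_norm]; simp
    rw [this]; simp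
  have hstep : ∀ θ, v (θ + Real.pi) - v θ = - (v θ * (1 + Complex.exp (Complex.I * α * Real.pi))) := by
    intro θ
    simp only [hv, hanti, hper]
    push_cast
    rw [mul_add, Complex.exp_add]
    ring
  have hnv : ∀ θ, ‖v θ‖ = ‖u θ‖ := by
    intro θ
    have h5 : Complex.I * α * (χ θ : ℂ) = ((α * χ θ : ℝ) : ℂ) * Complex.I := by push_cast; ring
    simp only [hv]
    rw [h5, norm_mul, Complex.norm_exp_ofReal_mul_I, mul_one]
  set J := ∫⁻ φ in Set.Ioo (-Real.pi) Real.pi, ‖w φ‖ₑ ^ 2 with hJ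
  have hmeas : Measurable fun φ => ‖deriv v φ‖ₑ := (measurable_deriv v).enorm
  have hpt0 : ∀ θ, -Real.pi < θ → θ ≤ 0 → ENNReal.ofReal (4 * |1 - α| ^ 2) * ‖u θ‖ₑ ^ 2 ≤ ENNReal.ofReal Real.pi * J := by
    intro θ h1 h2
    have hle : θ ≤ θ + Real.pi := by linarith [Real.pi_pos]
    have e1 := enorm_sub_le_lintegral_deriv_of_contDiffOn_Icc (hvc.contDiffOn (s := Set.Icc θ (θ + Real.pi))) hle
    have e2 := lt_cs (Set.Icc θ (θ + Real.pi)) _ hmeas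
    have e3 : volume (Set.Icc θ (θ + Real.pi)) = ENNReal.ofReal Real.pi := by simp
    have e4 : ∫⁻ x in Set.Icc θ (θ + Real.pi), ‖deriv v x‖ₑ ^ 2 ≤ J := by
      rw [hJ]; simp_rw [hderiv]
      rw [← restrict_Ioo_eq_restrict_Icc]
      apply lintegral_mono_set
      intro x hx
      exact ⟨by linarith [hx.1], by linarith [hx.2]⟩
    calc _ ≤ ‖v (θ + Real.pi) - v θ‖ₑ ^ 2 := by
          rw [hstep, ← ofReal_norm, ← ofReal_norm, norm_neg, norm_mul, hnv,
            ← ENNReal.ofReal_pow (by positivity), ← ENNReal.ofReal_pow (by positivity),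
            ← ENNReal.ofReal_mul (by positivity)]
          apply ENNReal.ofReal_le_ofReal
          have := lt_phase α hα
          have h7 : (2 * |1 - α|) ^ 2 ≤ ‖1 + Complex.exp (Complex.I * α * Real.pi)‖ ^ 2 := by gcongr
          rw [mul_pow ‖u θ‖]
          nlinarith [sq_nonneg ‖u θ‖]
      _ ≤ (∫⁻ x in Set.Icc θ (θ + Real.pi), ‖deriv v x‖ₑ) ^ 2 := by gcongr
      _ ≤ _ := e2
      _ ≤ _ := by rw [e3]; gcongr
  have hpt : ∀ θ ∈ Set.Ioo (-Real.pi) Real.pi, ENNReal.ofReal (4 * |1 - α| ^ 2) * ‖u θ‖ₑ ^ 2 ≤ ENNReal.ofReal Real.pi * J := by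
    intro θ hθ
    rcases le_or_gt θ 0 with h | h
    · exact hpt0 θ hθ.1 h
    · have := hpt0 (θ - Real.pi) (by linarith) (by linarith [hθ.2])
      have h8 := hanti (θ - Real.pi)
      rw [sub_add_cancel] at h8
      rw [h8, enorm_neg]; exact this
  have hIntg : ∫⁻ θ in Set.Ioo (-Real.pi) Real.pi, ENNReal.ofReal (4 * |1 - α| ^ 2) * ‖u θ‖ₑ ^ 2
      ≤ ∫⁻ θ in Set.Ioo (-Real.pi) Real.pi, ENNReal.ofReal Real.pi * J :=
    setLIntegral_mono' measurableSet_Ioo hpt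
  rw [lintegral_const_mul _ (by have := hu.continuous; fun_prop), setLIntegral_const, Real.volume_Ioo] at hIntg
  have h9 : ENNReal.ofReal (4 * |1 - α| ^ 2) = 4 * ENNReal.ofReal (|1 - α| ^ 2) := by
    rw [ENNReal.ofReal_mul (by norm_num)]; norm_num
  rw [h9, mul_assoc] at hIntg
  have h10 : ENNReal.ofReal Real.pi * J * ENNReal.ofReal (Real.pi - -Real.pi) ≤ 4 * (ENNReal.ofReal 5 * J) := by
    calc _ = (ENNReal.ofReal Real.pi * ENNReal.ofReal (Real.pi - -Real.pi)) * J := by ring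
      _ ≤ (4 * ENNReal.ofReal 5) * J := by
        gcongr ?_ * J
        rw [← ENNReal.ofReal_mul Real.pi_pos.le, show (4 : ENNReal) = ENNReal.ofReal 4 by norm_num,
          ← ENNReal.ofReal_mul (by norm_num)]
        apply ENNReal.ofReal_le_ofReal
        nlinarith [Real.pi_lt_d2, Real.pi_pos]
      _ = _ := by ring
  exact (ENNReal.mul_le_mul_iff_right (by norm_num) (by norm_num)).1 (hIntg.trans h10)

/-- The gauge phase produced by other particles on a circle. -/
def ltChi {ι : Type*} [Fintype ι] (z : ι → ℂ) (s : ℝ) (φ : ℝ) : ℝ :=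
  φ + ∑ l, ((Complex.log (1 - (s / 2) * Complex.exp (φ * Complex.I) / z l)).im
    + (Complex.log (1 + (s / 2) * Complex.exp (φ * Complex.I) / z l)).im)

lemma lt_slit (q : ℂ) (h : ‖q‖ < 1) : 1 + q ∈ Complex.slitPlane := Complex.mem_slitPlane_of_norm_lt_one h

lemma lt_normq (s φ : ℝ) (hs : 0 < s) (z : ℂ) (hz : s / 2 < ‖z‖) :
    ‖(s / 2 : ℂ) * Complex.exp (φ * Complex.I) / z‖ < 1 := by
  rw [norm_div, norm_mul, Complex.norm_exp_ofReal_mul_I, mul_one, div_lt_one (by linarith)]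
  have : ‖(s / 2 : ℂ)‖ = s / 2 := by
    rw [show (s / 2 : ℂ) = ((s / 2 : ℝ) : ℂ) by push_cast; ring, Complex.norm_real, Real.norm_of_nonneg (by linarith)]
  rw [this]; exact hz

lemma lt_chi_aux (s φ : ℝ) (hs : 0 < s) (z : ℂ) (hz : s / 2 < ‖z‖) :
    (1 - (s / 2 : ℂ) * Complex.exp (φ * Complex.I) / z ∈ Complex.slitPlane) ∧
    (1 + (s / 2 : ℂ) * Complex.exp (φ * Complex.I) / z ∈ Complex.slitPlane) := by
  have h := lt_normq s φ hs z hz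
  refine ⟨?_, lt_slit _ h⟩
  rw [sub_eq_add_neg]
  exact lt_slit _ (by rwa [norm_neg])

lemma lt_im_contDiff (f : ℝ → ℂ) (h : ContDiff ℝ 1 f) : ContDiff ℝ 1 (fun x => (f x).im) :=
  Complex.imCLM.contDiff.comp h

lemma lt_im_deriv {f : ℝ → ℂ} {f' : ℂ} {x : ℝ} (h : HasDerivAt f f' x) :
    HasDerivAt (fun x => (f x).im) f'.im x :=
  Complex.imCLM.hasFDerivAt.comp_hasDerivAt x h

lemma lt_chi_contDiff {ι : Type*} [Fintype ι] (z : ι → ℂ) (s : ℝ) (hs : 0 < s) (hz : ∀ l, s / 2 < ‖z l‖) :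
    ContDiff ℝ 1 (ltChi z s) := by
  unfold ltChi
  have hE : ContDiff ℝ 1 (fun φ : ℝ => Complex.exp (φ * Complex.I)) :=
    (Complex.ofRealCLM.contDiff.mul contDiff_const).cexp
  apply contDiff_id.add
  apply ContDiff.sum
  intro l _
  apply ContDiff.add
  · apply lt_im_contDiff
    rw [contDiff_iff_contDiffAt]
    intro φ
    refine ContDiffAt.comp φ (g := Complex.log) ((Complex.contDiffAt_log ?_).restrict_scalars ℝ) ?_
    rotate_left
    · exact (contDiff_const.sub ((contDiff_const.mul hE).div_const _)).contDiffAt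
    · exact (lt_chi_aux s φ hs (z l) (hz l)).1
  · apply lt_im_contDiff
    rw [contDiff_iff_contDiffAt]
    intro φ
    refine ContDiffAt.comp φ (g := Complex.log) ((Complex.contDiffAt_log ?_).restrict_scalars ℝ) ?_
    rotate_left
    · exact (contDiff_const.add ((contDiff_const.mul hE).div_const _)).contDiffAt
    · exact (lt_chi_aux s φ hs (z l) (hz l)).2

lemma lt_chi_deriv {ι : Type*} [Fintype ι] (z : ι → ℂ) (s : ℝ) (hs : 0 < s) (hz : ∀ l, s / 2 < ‖z l‖) (φ : ℝ) :
    deriv (ltChi z s) φ = 1 + ∑ l, (((s / 2) * Complex.exp (φ * Complex.I)) / ((s / 2) * Complex.exp (φ * Complex.I) - z l)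
      + ((s / 2) * Complex.exp (φ * Complex.I)) / ((s / 2) * Complex.exp (φ * Complex.I) + z l)).re := by
  have hE : HasDerivAt (fun φ : ℝ => (s / 2 : ℂ) * Complex.exp (φ * Complex.I))
      ((s / 2 : ℂ) * Complex.exp (φ * Complex.I) * Complex.I) φ := by
    have h1 : HasDerivAt (fun φ : ℝ => (φ : ℂ) * Complex.I) (Complex.I) φ := by
      simpa using (hasDerivAt_id φ).ofReal_comp.mul_const Complex.I
    exact (h1.cexp.const_mul (s / 2 : ℂ)).congr_deriv (by ring)
  apply HasDerivAt.deriv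
  unfold ltChi
  apply (hasDerivAt_id φ).add
  apply HasDerivAt.fun_sum
  intro l _
  have hz0 : z l ≠ 0 := by
    intro h; have := hz l; rw [h] at this; simp at this; linarith
  obtain ⟨m1, m2⟩ := lt_chi_aux s φ hs (z l) (hz l)
  set q := (s / 2 : ℂ) * Complex.exp (φ * Complex.I) with hq
  have n1 := Complex.slitPlane_ne_zero m1
  have n2 := Complex.slitPlane_ne_zero m2
  have n1' : q - z l ≠ 0 := by
    intro h; apply n1; rw [sub_eq_zero.1 h]; field_simp; simp
  have n2' : q + z l ≠ 0 := by
    intro h; apply n2; rw [eq_neg_of_add_eq_zero_left h]; field_simp; simp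
  rw [Complex.add_re]
  apply HasDerivAt.add
  · have h2 : HasDerivAt (fun φ : ℝ => Complex.log (1 - (s / 2 : ℂ) * Complex.exp (φ * Complex.I) / z l)) _ φ :=
      ((hE.div_const (z l)).const_sub 1).clog_real m1
    refine (lt_im_deriv h2).congr_deriv ?_
    rw [← hq]
    have : -(q * Complex.I / z l) / (1 - q / z l) = (q / (q - z l)) * Complex.I := by
      have : (1 - q / z l) = -(q - z l) / z l := by field_simp; ring
      rw [this]
      field_simp
    rw [this, Complex.mul_I_im]
  · have h2 : HasDerivAt (fun φ : ℝ => Complex.log (1 + (s / 2 : ℂ) * Complex.exp (φ * Complex.I) / z l)) _ φ :=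
      ((hE.div_const (z l)).const_add 1).clog_real m2
    refine (lt_im_deriv h2).congr_deriv ?_
    rw [← hq]
    have : (q * Complex.I / z l) / (1 + q / z l) = (q / (q + z l)) * Complex.I := by
      have : (1 + q / z l) = (q + z l) / z l := by field_simp; ring
      rw [this]
      field_simp
    rw [this, Complex.mul_I_im]

lemma lt_chi_per {ι : Type*} [Fintype ι] (z : ι → ℂ) (s : ℝ) (φ : ℝ) :
    ltChi z s (φ + Real.pi) = ltChi z s φ + Real.pi := by
  unfold ltChi
  have : Complex.exp (((φ + Real.pi : ℝ) : ℂ) * Complex.I) = - Complex.exp (φ * Complex.I) := by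
    push_cast
    rw [add_mul, Complex.exp_add, Complex.exp_pi_mul_I]; ring
  rw [this]
  have h2 : ∀ l, (s / 2 : ℂ) * (-Complex.exp (φ * Complex.I)) / z l = - ((s / 2 : ℂ) * Complex.exp (φ * Complex.I) / z l) := by
    intro l; ring
  simp_rw [h2, sub_neg_eq_add, ← sub_eq_add_neg]
  simp_rw [add_comm (Complex.im (Complex.log (1 + _)))]
  ring

lemma lt_polar (F : ℂ → ENNReal) (hF : Measurable F) :
    ∫⁻ r, F r = ∫⁻ θ in Set.Ioo (-Real.pi) Real.pi, ∫⁻ s in Set.Ioi (0:ℝ),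
      ENNReal.ofReal s * F (s * Complex.exp (θ * Complex.I)) := by
  rw [← Complex.lintegral_comp_polarCoord_symm, polarCoord_target, Measure.volume_eq_prod,
    ← Measure.prod_restrict, lintegral_prod_symm]
  · simp only [Complex.polarCoord_symm_apply, smul_eq_mul, Complex.exp_mul_I]
    simp only [Complex.ofReal_cos, Complex.ofReal_sin]
  · apply Measurable.aemeasurable
    simp only [Complex.polarCoord_symm_apply, smul_eq_mul]
    fun_prop

lemma lt_polar' (F : ℂ → ENNReal) (hF : Measurable F) :
    ∫⁻ r, F r = ∫⁻ s in Set.Ioi (0:ℝ), ∫⁻ θ in Set.Ioo (-Real.pi) Real.pi, 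
      ENNReal.ofReal s * F (s * Complex.exp (θ * Complex.I)) := by
  rw [lt_polar F hF, lintegral_lintegral_swap]
  apply Measurable.aemeasurable
  simp only [Function.uncurry_def]
  fun_prop

lemma lt_enorm_sq (x : ℂ) : ENNReal.ofReal (‖x‖ ^ 2) = ‖x‖ₑ ^ 2 := by
  rw [ENNReal.ofReal_pow (norm_nonneg _), ofReal_norm]

lemma lt_dsq (z w : ℂ) (c : ℝ) :
    |2 * inner ℝ z (Complex.I * w - Complex.I * c * z)| ≤ 2 * ‖z‖ * ‖w‖ := by
  have h : inner ℝ z (Complex.I * w - Complex.I * c * z) = inner ℝ z (Complex.I * w) := by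
    rw [inner_sub_right]
    have : inner ℝ z (Complex.I * c * z) = 0 := by
      rw [Complex.inner]
      simp [Complex.mul_re, Complex.mul_im]
      ring
    rw [this, sub_zero]
  rw [h, abs_mul, abs_two, mul_assoc]
  have := abs_real_inner_le_norm z (Complex.I * w)
  rw [norm_mul, Complex.norm_I, one_mul] at this
  linarith

lemma lt_cs2 (x y : ℝ) (p q : ℂ) :
    ‖(x : ℂ) * p + y * q‖ ≤ √(x ^ 2 + y ^ 2) * √(‖p‖ ^ 2 + ‖q‖ ^ 2) := by
  have h1 : ‖(x : ℂ) * p + y * q‖ ≤ |x| * ‖p‖ + |y| * ‖q‖ := by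
    refine (norm_add_le _ _).trans ?_
    simp [Complex.norm_real]
  refine h1.trans ?_
  rw [← Real.sqrt_mul (by positivity)]
  apply Real.le_sqrt_of_sq_le
  have e1 := sq_abs x
  have e2 := sq_abs y
  nlinarith [sq_nonneg (|x| * ‖q‖ - |y| * ‖p‖)]

section core
variable {ι : Type*} [Fintype ι]

lemma lt_circ (α : ℝ) (hα : α ∈ Set.Icc (0 : ℝ) 2) (z : ι → ℂ) (D : ℝ)
    (hz : ∀ l, D ≤ ‖z l‖) (u W1 W2 a : ℂ → ℂ) (hu : ContDiff ℝ 1 u) (hodd : ∀ r, u (-r) = - u r)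
    (hder : ∀ r v : ℂ, fderiv ℝ u r v = Complex.I * (v.re * W1 r + v.im * W2 r)
      - Complex.I * α * (((a r).re * v.re + (a r).im * v.im : ℝ) : ℂ) * u r)
    (ha : ∀ r : ℂ, 0 < ‖r‖ → ‖r‖ < 2 * D / 3 →
      (a r).re * (Complex.I * r).re + (a r).im * (Complex.I * r).im
        = 1 + ∑ l, ((r / 2) / (r / 2 - z l) + (r / 2) / (r / 2 + z l)).re)
    (s : ℝ) (hs : 0 < s) (hs2 : s < 2 * D / 3) :
    ENNReal.ofReal (|1 - α| ^ 2) * ∫⁻ φ in Set.Ioo (-Real.pi) Real.pi,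
        ENNReal.ofReal (‖u (s * Complex.exp (φ * Complex.I))‖ ^ 2)
      ≤ ENNReal.ofReal (5 * s ^ 2) * ∫⁻ φ in Set.Ioo (-Real.pi) Real.pi,
        ENNReal.ofReal (‖W1 (s * Complex.exp (φ * Complex.I))‖ ^ 2 + ‖W2 (s * Complex.exp (φ * Complex.I))‖ ^ 2) := by
  set c : ℝ → ℂ := fun φ => s * Complex.exp (φ * Complex.I) with hc
  have hcn : ∀ φ, ‖c φ‖ = s := by
    intro φ
    simp only [hc, norm_mul, Complex.norm_exp_ofReal_mul_I, mul_one, Complex.norm_real]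
    exact Real.norm_of_nonneg hs.le
  have hcc : ContDiff ℝ 1 c :=
    contDiff_const.mul (Complex.ofRealCLM.contDiff.mul contDiff_const).cexp
  have hcd : ∀ φ, HasDerivAt c (Complex.I * c φ) φ := by
    intro φ
    have h1 : HasDerivAt (fun φ : ℝ => (φ : ℂ) * Complex.I) (Complex.I) φ := by
      simpa using (hasDerivAt_id φ).ofReal_comp.mul_const Complex.I
    exact (h1.cexp.const_mul (s : ℂ)).congr_deriv (by simp only [hc]; ring)
  have hzs : ∀ l, s / 2 < ‖z l‖ := fun l => by have := hz l; linarith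
  have key := lt_angular α hα (fun φ => u (c φ))
    (fun φ => (Complex.I * c φ).re * W1 (c φ) + (Complex.I * c φ).im * W2 (c φ)) (ltChi z s)
    (hu.comp hcc) (lt_chi_contDiff z s hs hzs) ?_ (lt_chi_per z s) ?_
  · simp_rw [lt_enorm_sq] at *
    refine key.trans ?_
    rw [ENNReal.ofReal_mul (by norm_num), mul_assoc]
    gcongr
    rw [← lintegral_const_mul' _ _ ENNReal.ofReal_ne_top]
    apply lintegral_mono
    intro φ
    simp only
    rw [← lt_enorm_sq, ← ENNReal.ofReal_mul (by positivity)]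
    apply ENNReal.ofReal_le_ofReal
    have h1 := lt_cs2 (Complex.I * c φ).re (Complex.I * c φ).im (W1 (c φ)) (W2 (c φ))
    have h2 : (Complex.I * c φ).re ^ 2 + (Complex.I * c φ).im ^ 2 = s ^ 2 := by
      have : ‖Complex.I * c φ‖ ^ 2 = s ^ 2 := by rw [norm_mul, Complex.norm_I, hcn, one_mul]
      rw [← this, Complex.sq_norm, Complex.normSq_apply]; ring
    calc _ ≤ (√((Complex.I * c φ).re ^ 2 + (Complex.I * c φ).im ^ 2) * √(‖W1 (c φ)‖ ^ 2 + ‖W2 (c φ)‖ ^ 2)) ^ 2 := by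
          gcongr
      _ = _ := by rw [mul_pow, Real.sq_sqrt (by positivity), Real.sq_sqrt (by positivity), h2]
  · intro φ
    have h1 : HasDerivAt (fun φ => u (c φ)) (fderiv ℝ u (c φ) (Complex.I * c φ)) φ :=
      ((hu.differentiable (by norm_num)) (c φ)).hasFDerivAt.comp_hasDerivAt φ (hcd φ)
    rw [h1.deriv, hder, ha (c φ) (by rw [hcn]; exact hs) (by rw [hcn]; exact hs2),
      lt_chi_deriv z s hs hzs]
    have : (s : ℂ) / 2 * Complex.exp (φ * Complex.I) = c φ / 2 := by simp only [hc]; ring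
    simp_rw [this]
  · intro φ
    have : c (φ + Real.pi) = - c φ := by
      simp only [hc]; push_cast
      rw [add_mul, Complex.exp_add, Complex.exp_pi_mul_I]; ring
    simp only [this, hodd]

lemma lt_ball (α : ℝ) (hα : α ∈ Set.Icc (0 : ℝ) 2) (z : ι → ℂ) (D : ℝ)
    (hz : ∀ l, D ≤ ‖z l‖) (u W1 W2 a : ℂ → ℂ) (hu : ContDiff ℝ 1 u) (hodd : ∀ r, u (-r) = - u r)
    (hW1 : Measurable W1) (hW2 : Measurable W2)
    (hder : ∀ r v : ℂ, fderiv ℝ u r v = Complex.I * (v.re * W1 r + v.im * W2 r)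
      - Complex.I * α * (((a r).re * v.re + (a r).im * v.im : ℝ) : ℂ) * u r)
    (ha : ∀ r : ℂ, 0 < ‖r‖ → ‖r‖ < 2 * D / 3 →
      (a r).re * (Complex.I * r).re + (a r).im * (Complex.I * r).im
        = 1 + ∑ l, ((r / 2) / (r / 2 - z l) + (r / 2) / (r / 2 + z l)).re) :
    ENNReal.ofReal (|1 - α| ^ 2) * ∫⁻ r in {r : ℂ | ‖r‖ < 2 * D / 3},
        ENNReal.ofReal (‖u r‖ ^ 2 / ‖r‖ ^ 2)
      ≤ ENNReal.ofReal 5 * ∫⁻ r in {r : ℂ | ‖r‖ < 2 * D / 3},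
        ENNReal.ofReal (‖W1 r‖ ^ 2 + ‖W2 r‖ ^ 2) := by
  have hB : MeasurableSet {r : ℂ | ‖r‖ < 2 * D / 3} := measurableSet_lt measurable_norm measurable_const
  have hum := hu.continuous.measurable
  rw [← lintegral_indicator hB, ← lintegral_indicator hB]
  rw [lt_polar' _ (Measurable.indicator (by fun_prop) hB), lt_polar' _ (Measurable.indicator (by fun_prop) hB)]
  rw [← lintegral_const_mul' _ _ ENNReal.ofReal_ne_top, ← lintegral_const_mul' _ _ ENNReal.ofReal_ne_top]
  apply setLIntegral_mono' measurableSet_Ioi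
  intro s hs
  have hs : 0 < s := hs
  have hcn : ∀ φ : ℝ, ‖(s : ℂ) * Complex.exp (φ * Complex.I)‖ = s := by
    intro φ
    simp only [norm_mul, Complex.norm_exp_ofReal_mul_I, mul_one, Complex.norm_real]
    exact Real.norm_of_nonneg hs.le
  simp only [Set.indicator, Set.mem_ofPred_eq, hcn]
  split_ifs with h
  · have key := lt_circ α hα z D hz u W1 W2 a hu hodd hder ha s hs h
    rw [lintegral_const_mul' _ _ ENNReal.ofReal_ne_top, lintegral_const_mul' _ _ ENNReal.ofReal_ne_top]
    have e : ∀ φ : ℝ, ENNReal.ofReal (‖u (s * Complex.exp (φ * Complex.I))‖ ^ 2 / s ^ 2)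
        = ENNReal.ofReal (1 / s ^ 2) * ENNReal.ofReal (‖u (s * Complex.exp (φ * Complex.I))‖ ^ 2) := by
      intro φ
      rw [← ENNReal.ofReal_mul (by positivity)]; congr 1; ring
    simp_rw [e]
    rw [lintegral_const_mul' _ _ ENNReal.ofReal_ne_top]
    calc _ = ENNReal.ofReal s * ENNReal.ofReal (1 / s ^ 2) * (ENNReal.ofReal (|1 - α| ^ 2) * ∫⁻ φ in Set.Ioo (-Real.pi) Real.pi,
        ENNReal.ofReal (‖u (s * Complex.exp (φ * Complex.I))‖ ^ 2)) := by ring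
      _ ≤ ENNReal.ofReal s * ENNReal.ofReal (1 / s ^ 2) * (ENNReal.ofReal (5 * s ^ 2) * ∫⁻ φ in Set.Ioo (-Real.pi) Real.pi,
        ENNReal.ofReal (‖W1 (s * Complex.exp (φ * Complex.I))‖ ^ 2 + ‖W2 (s * Complex.exp (φ * Complex.I))‖ ^ 2)) :=
          mul_le_mul_right key _
      _ = (ENNReal.ofReal (1 / s ^ 2) * ENNReal.ofReal (5 * s ^ 2)) * (ENNReal.ofReal s * ∫⁻ φ in Set.Ioo (-Real.pi) Real.pi,
        ENNReal.ofReal (‖W1 (s * Complex.exp (φ * Complex.I))‖ ^ 2 + ‖W2 (s * Complex.exp (φ * Complex.I))‖ ^ 2)) := by ring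
      _ = _ := by
        rw [← ENNReal.ofReal_mul (by positivity)]
        congr 3
        field_simp
  · simp

lemma lt_radial (α : ℝ) (u W1 W2 a : ℂ → ℂ) (hu : ContDiff ℝ 1 u) (hodd : ∀ r, u (-r) = - u r)
    (hder : ∀ r v : ℂ, fderiv ℝ u r v = Complex.I * (v.re * W1 r + v.im * W2 r)
      - Complex.I * α * (((a r).re * v.re + (a r).im * v.im : ℝ) : ℂ) * u r)
    (e : ℂ) (he : ‖e‖ = 1) (s : ℝ) (hs : 0 < s) :
    ENNReal.ofReal (‖u (s * e)‖ ^ 2) ≤ ∫⁻ t in Set.Ioo 0 s,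
      ENNReal.ofReal (2 * ‖u (t * e)‖ * √(‖W1 (t * e)‖ ^ 2 + ‖W2 (t * e)‖ ^ 2)) := by
  have hl : ContDiff ℝ 1 (fun t : ℝ => (t : ℂ) * e) := Complex.ofRealCLM.contDiff.mul contDiff_const
  have hf : ContDiff ℝ 1 (fun t : ℝ => ‖u (t * e)‖ ^ 2) := ContDiff.norm_sq ℝ (hu.comp hl)
  have h := enorm_sub_le_lintegral_deriv_of_contDiffOn_Icc (a := 0) (b := s) hf.contDiffOn hs.le
  have u0 : u 0 = 0 := by
    have := hodd 0
    rw [neg_zero] at this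
    exact self_eq_neg.1 this
  simp only [Complex.ofReal_zero, zero_mul, u0, norm_zero] at h
  rw [show ‖u (s * e)‖ ^ 2 - 0 ^ 2 = ‖u (s * e)‖ ^ 2 by ring, Real.enorm_of_nonneg (by positivity)] at h
  refine h.trans ?_
  rw [restrict_Ioo_eq_restrict_Icc]
  apply lintegral_mono
  intro t
  simp only
  have hd : HasDerivAt (fun t : ℝ => u (t * e)) (fderiv ℝ u (t * e) e) t := by
    refine ((hu.differentiable (by norm_num)) ((t : ℂ) * e)).hasFDerivAt.comp_hasDerivAt t ?_
    simpa using (hasDerivAt_id t).ofReal_comp.mul_const e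
  rw [hd.norm_sq.deriv, hder, ← ofReal_norm, Real.norm_eq_abs]
  apply ENNReal.ofReal_le_ofReal
  rw [mul_assoc Complex.I (α : ℂ), ← Complex.ofReal_mul]
  refine (lt_dsq _ _ _).trans ?_
  gcongr
  refine (lt_cs2 _ _ _ _).trans ?_
  have : e.re ^ 2 + e.im ^ 2 = 1 := by
    have : ‖e‖ ^ 2 = 1 := by rw [he]; norm_num
    rw [← this, Complex.sq_norm, Complex.normSq_apply]; ring
  rw [this]; simp

lemma lt_star (α : ℝ) (D : ℝ) (hD : 0 < D) (u W1 W2 a : ℂ → ℂ) (hu : ContDiff ℝ 1 u) (hodd : ∀ r, u (-r) = - u r)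
    (hW1 : Measurable W1) (hW2 : Measurable W2)
    (hder : ∀ r v : ℂ, fderiv ℝ u r v = Complex.I * (v.re * W1 r + v.im * W2 r)
      - Complex.I * α * (((a r).re * v.re + (a r).im * v.im : ℝ) : ℂ) * u r)
    (A : Set ℂ) (hA : MeasurableSet A) (hstar : ∀ r ∈ A, ∀ l : ℝ, 0 < l → l < 1 → (l : ℂ) * r ∈ A)
    (hA2 : ∀ r ∈ A, ‖r‖ ≤ 2 * D) :
    ∫⁻ r in A, ENNReal.ofReal (‖u r‖ ^ 2) ≤ ENNReal.ofReal (2 * D ^ 2) * ∫⁻ r in A,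
      ENNReal.ofReal (2 * ‖u r‖ * √(‖W1 r‖ ^ 2 + ‖W2 r‖ ^ 2) / ‖r‖) := by
  have hum := hu.continuous.measurable
  rw [← lintegral_indicator hA, ← lintegral_indicator hA]
  rw [lt_polar _ (Measurable.indicator (by fun_prop) hA), lt_polar _ (Measurable.indicator (by fun_prop) hA)]
  rw [← lintegral_const_mul' _ _ ENNReal.ofReal_ne_top]
  apply lintegral_mono
  intro θ
  simp only
  set e := Complex.exp (θ * Complex.I) with he
  have hen : ‖e‖ = 1 := Complex.norm_exp_ofReal_mul_I θ
  have hcn : ∀ s : ℝ, 0 < s → ‖(s : ℂ) * e‖ = s := by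
    intro s hs
    simp only [norm_mul, hen, mul_one, Complex.norm_real]
    exact Real.norm_of_nonneg hs.le
  set g : ℝ → ENNReal := fun t => Set.indicator {t : ℝ | (t : ℂ) * e ∈ A}
    (fun t => ENNReal.ofReal (2 * ‖u (t * e)‖ * √(‖W1 (t * e)‖ ^ 2 + ‖W2 (t * e)‖ ^ 2))) t with hg
  have h1 : ∫⁻ s in Set.Ioi (0:ℝ), ENNReal.ofReal s * A.indicator (fun r => ENNReal.ofReal (‖u r‖ ^ 2)) (s * e)
      ≤ ∫⁻ s in Set.Ioi (0:ℝ), (Set.Ioc 0 (2 * D)).indicator (fun s => ENNReal.ofReal s) s * ∫⁻ t in Set.Ioi (0:ℝ), g t := by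
    apply setLIntegral_mono' measurableSet_Ioi
    intro s hs
    have hs : 0 < s := hs
    by_cases hsA : (s : ℂ) * e ∈ A
    · have hs2 : s ≤ 2 * D := by rw [← hcn s hs]; exact hA2 _ hsA
      rw [Set.indicator_of_mem hsA, Set.indicator_of_mem (show s ∈ Set.Ioc 0 (2 * D) from ⟨hs, hs2⟩)]
      gcongr
      refine (lt_radial α u W1 W2 a hu hodd hder e hen s hs).trans ?_
      have : ∫⁻ t in Set.Ioo 0 s,
          ENNReal.ofReal (2 * ‖u (t * e)‖ * √(‖W1 (t * e)‖ ^ 2 + ‖W2 (t * e)‖ ^ 2)) = ∫⁻ t in Set.Ioo 0 s, g t := by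
        apply setLIntegral_congr_fun measurableSet_Ioo
        intro t ht
        simp only [hg]
        rw [Set.indicator_of_mem]
        have := hstar _ hsA (t / s) (div_pos ht.1 hs) ((div_lt_one hs).2 ht.2)
        rw [← mul_assoc] at this
        have h3 : ((t / s : ℝ) : ℂ) * s = t := by
          rw [← Complex.ofReal_mul, div_mul_cancel₀ _ hs.ne']
        rw [h3] at this
        exact this
      rw [this]
      exact lintegral_mono_set (fun t ht => ht.1)
    · rw [Set.indicator_of_notMem hsA]; simp
  refine h1.trans ?_
  rw [lintegral_mul_const _ (Measurable.indicator (by fun_prop) measurableSet_Ioc)]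
  have h2 : ∫⁻ s in Set.Ioi (0:ℝ), (Set.Ioc 0 (2 * D)).indicator (fun s => ENNReal.ofReal s) s = ENNReal.ofReal (2 * D ^ 2) := by
    rw [lintegral_indicator measurableSet_Ioc, Measure.restrict_restrict measurableSet_Ioc,
      Set.inter_eq_left.2 (fun x hx => hx.1)]
    rw [← ofReal_integral_eq_lintegral_ofReal]
    · rw [← intervalIntegral.integral_of_le (by linarith), integral_id]
      congr 1; ring
    · exact (continuous_id.integrableOn_Icc (a := 0) (b := 2 * D)).mono_set Set.Ioc_subset_Icc_self
    · filter_upwards [ae_restrict_mem measurableSet_Ioc] with s hs using hs.1.le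
  rw [h2]
  refine mul_le_mul_right (setLIntegral_mono' measurableSet_Ioi ?_) _
  intro t ht
  have ht : 0 < t := ht
  simp only [hg, Set.indicator, Set.mem_ofPred_eq]
  split_ifs with h
  · rw [hcn t ht, ← ENNReal.ofReal_mul ht.le]
    apply le_of_eq; congr 1; field_simp
  · simp

lemma lt_core (α : ℝ) (hα : α ∈ Set.Icc (0 : ℝ) 2) (hα1 : α ≠ 1) (z : ι → ℂ) (D : ℝ) (hD : 0 < D)
    (hz : ∀ l, D ≤ ‖z l‖) (u W1 W2 a : ℂ → ℂ) (hu : ContDiff ℝ 1 u) (hodd : ∀ r, u (-r) = - u r)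
    (hW1 : Measurable W1) (hW2 : Measurable W2)
    (hder : ∀ r v : ℂ, fderiv ℝ u r v = Complex.I * (v.re * W1 r + v.im * W2 r)
      - Complex.I * α * (((a r).re * v.re + (a r).im * v.im : ℝ) : ℂ) * u r)
    (ha : ∀ r : ℂ, 0 < ‖r‖ → ‖r‖ < 2 * D / 3 →
      (a r).re * (Complex.I * r).re + (a r).im * (Complex.I * r).im
        = 1 + ∑ l, ((r / 2) / (r / 2 - z l) + (r / 2) / (r / 2 + z l)).re)
    (A : Set ℂ) (hA : MeasurableSet A) (hstar : ∀ r ∈ A, ∀ l : ℝ, 0 < l → l < 1 → (l : ℂ) * r ∈ A)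
    (hA1 : ∀ r : ℂ, 0 < ‖r‖ → ‖r‖ < 2 * D / 3 → r ∈ A)
    (hA2 : ∀ r ∈ A, ‖r‖ ≤ 2 * D) :
    ∫⁻ r in A, ENNReal.ofReal (‖u r‖ ^ 2) ≤ ENNReal.ofReal (60 * D ^ 2 / |1 - α|) * ∫⁻ r in A,
      ENNReal.ofReal (‖W1 r‖ ^ 2 + ‖W2 r‖ ^ 2) := by
  have hum := hu.continuous.measurable
  set ν := |1 - α| with hν
  have hν0 : 0 < ν := abs_pos.2 (sub_ne_zero.2 (Ne.symm hα1))
  have hν1 : ν ≤ 1 := abs_le.2 ⟨by linarith [hα.2], by linarith [hα.1]⟩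
  have h1 := lt_star α D hD u W1 W2 a hu hodd hW1 hW2 hder A hA hstar hA2
  have h2 := lt_ball α hα z D hz u W1 W2 a hu hodd hW1 hW2 hder ha
  rw [← hν] at h2
  set B := {r : ℂ | ‖r‖ < 2 * D / 3} with hB
  have hBm : MeasurableSet B := measurableSet_lt measurable_norm measurable_const
  set V : ℂ → ENNReal := fun r => ENNReal.ofReal (‖W1 r‖ ^ 2 + ‖W2 r‖ ^ 2) with hV
  have hVm : Measurable V := by simp only [hV]; fun_prop
  set U : ℂ → ENNReal := fun r => ENNReal.ofReal (‖u r‖ ^ 2) with hU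
  have hUm : Measurable U := by simp only [hU]; fun_prop
  set P : ℂ → ENNReal := fun r => ENNReal.ofReal (‖u r‖ ^ 2 / ‖r‖ ^ 2) with hP
  have hPm : Measurable P := by simp only [hP]; fun_prop
  -- B integral of V at most A integral
  have hBA : ∫⁻ r in B, V r ≤ ∫⁻ r in A, V r := by
    apply lintegral_mono_set' 
    have : ∀ᵐ r : ℂ, r ≠ 0 := by
      simp [ae_iff]
    filter_upwards [this] with r hr hrB
    exact hA1 r (norm_pos_iff.2 hr) hrB
  have young : ∀ (κ x w : ℝ), 0 < κ → 2 * x * w ≤ κ * x ^ 2 + w ^ 2 / κ := by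
    intro κ x w hκ
    have : κ * x ^ 2 + w ^ 2 / κ - 2 * x * w = (κ * x - w) ^ 2 / κ := by field_simp; ring
    have h3 : 0 ≤ (κ * x - w) ^ 2 / κ := by positivity
    linarith
  have hpt : ∀ r ∈ A, ENNReal.ofReal (2 * ‖u r‖ * √(‖W1 r‖ ^ 2 + ‖W2 r‖ ^ 2) / ‖r‖)
      ≤ B.indicator (fun r => ENNReal.ofReal ν * P r + ENNReal.ofReal (1 / ν) * V r) r
        + (ENNReal.ofReal (1 / (4 * D ^ 2)) * U r + ENNReal.ofReal 9 * V r) := by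
    intro r hr
    have hVs : √(‖W1 r‖ ^ 2 + ‖W2 r‖ ^ 2) ^ 2 = ‖W1 r‖ ^ 2 + ‖W2 r‖ ^ 2 := Real.sq_sqrt (by positivity)
    by_cases hrB : r ∈ B
    · rw [Set.indicator_of_mem hrB]
      refine le_trans ?_ le_self_add
      rw [← ENNReal.ofReal_mul hν0.le, ← ENNReal.ofReal_mul (by positivity), ← ENNReal.ofReal_add (by positivity) (by positivity)]
      apply ENNReal.ofReal_le_ofReal
      have := young ν (‖u r‖ / ‖r‖) (√(‖W1 r‖ ^ 2 + ‖W2 r‖ ^ 2)) hν0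
      rw [hVs] at this
      calc _ = 2 * (‖u r‖ / ‖r‖) * √(‖W1 r‖ ^ 2 + ‖W2 r‖ ^ 2) := by ring
        _ ≤ _ := this
        _ = _ := by rw [div_pow]; ring
    · rw [Set.indicator_of_notMem hrB, zero_add]
      rw [← ENNReal.ofReal_mul (by positivity), ← ENNReal.ofReal_mul (by positivity), ← ENNReal.ofReal_add (by positivity) (by positivity)]
      apply ENNReal.ofReal_le_ofReal
      have hr3 : 2 * D / 3 ≤ ‖r‖ := not_lt.1 hrB
      have hx : (‖u r‖ / ‖r‖) ^ 2 ≤ 9 * (‖u r‖ ^ 2 / (4 * D ^ 2)) := by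
        have : (‖u r‖ / ‖r‖) ≤ ‖u r‖ / (2 * D / 3) := by gcongr
        calc _ ≤ (‖u r‖ / (2 * D / 3)) ^ 2 := by gcongr
          _ = _ := by field_simp; ring
      have := young (1 / 9) (‖u r‖ / ‖r‖) (√(‖W1 r‖ ^ 2 + ‖W2 r‖ ^ 2)) (by norm_num)
      rw [hVs] at this
      calc _ = 2 * (‖u r‖ / ‖r‖) * √(‖W1 r‖ ^ 2 + ‖W2 r‖ ^ 2) := by ring
        _ ≤ _ := this
        _ ≤ 1 / 9 * (9 * (‖u r‖ ^ 2 / (4 * D ^ 2))) + (‖W1 r‖ ^ 2 + ‖W2 r‖ ^ 2) / (1 / 9) := by gcongr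
        _ = _ := by ring
  have hBint : ENNReal.ofReal ν * ∫⁻ r in B, P r ≤ ENNReal.ofReal (5 / ν) * ∫⁻ r in A, V r := by
    calc ENNReal.ofReal ν * ∫⁻ r in B, P r = ENNReal.ofReal (1 / ν) * (ENNReal.ofReal (ν ^ 2) * ∫⁻ r in B, P r) := by
          rw [← mul_assoc, ← ENNReal.ofReal_mul (by positivity)]
          congr 2; field_simp
      _ ≤ ENNReal.ofReal (1 / ν) * (ENNReal.ofReal 5 * ∫⁻ r in B, V r) := mul_le_mul_right h2 _
      _ ≤ ENNReal.ofReal (1 / ν) * (ENNReal.ofReal 5 * ∫⁻ r in A, V r) := by gcongr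
      _ = _ := by
          rw [← mul_assoc, ← ENNReal.ofReal_mul (by positivity)]
          congr 2; ring
  have h3 : ∫⁻ r in A, ENNReal.ofReal (2 * ‖u r‖ * √(‖W1 r‖ ^ 2 + ‖W2 r‖ ^ 2) / ‖r‖)
      ≤ ENNReal.ofReal (15 / ν) * (∫⁻ r in A, V r) + ENNReal.ofReal (1 / (4 * D ^ 2)) * ∫⁻ r in A, U r := by
    calc _ ≤ ∫⁻ r in A, (B.indicator (fun r => ENNReal.ofReal ν * P r + ENNReal.ofReal (1 / ν) * V r) r
        + (ENNReal.ofReal (1 / (4 * D ^ 2)) * U r + ENNReal.ofReal 9 * V r)) := setLIntegral_mono' hA hpt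
      _ = (∫⁻ r in A, B.indicator (fun r => ENNReal.ofReal ν * P r + ENNReal.ofReal (1 / ν) * V r) r)
          + (ENNReal.ofReal (1 / (4 * D ^ 2)) * (∫⁻ r in A, U r) + ENNReal.ofReal 9 * ∫⁻ r in A, V r) := by
        rw [lintegral_add_left (Measurable.indicator (by fun_prop) hBm), lintegral_add_left (by fun_prop),
          lintegral_const_mul _ hUm, lintegral_const_mul _ hVm]
      _ ≤ (∫⁻ r in B, (ENNReal.ofReal ν * P r + ENNReal.ofReal (1 / ν) * V r))
          + (ENNReal.ofReal (1 / (4 * D ^ 2)) * (∫⁻ r in A, U r) + ENNReal.ofReal 9 * ∫⁻ r in A, V r) := by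
        refine add_le_add ?_ le_rfl
        rw [← lintegral_indicator hBm]
        exact setLIntegral_le_lintegral _ _
      _ = (ENNReal.ofReal ν * (∫⁻ r in B, P r) + ENNReal.ofReal (1 / ν) * ∫⁻ r in B, V r)
          + (ENNReal.ofReal (1 / (4 * D ^ 2)) * (∫⁻ r in A, U r) + ENNReal.ofReal 9 * ∫⁻ r in A, V r) := by
        rw [lintegral_add_left (by fun_prop),
          lintegral_const_mul _ hPm, lintegral_const_mul _ hVm]
      _ ≤ (ENNReal.ofReal (5 / ν) * (∫⁻ r in A, V r) + ENNReal.ofReal (1 / ν) * ∫⁻ r in A, V r)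
          + (ENNReal.ofReal (1 / (4 * D ^ 2)) * (∫⁻ r in A, U r) + ENNReal.ofReal (9 / ν) * ∫⁻ r in A, V r) := by
        gcongr
        exact le_div_self (by norm_num) hν0 hν1
      _ = _ := by
        have e : ENNReal.ofReal (15 / ν) = ENNReal.ofReal (5 / ν) + ENNReal.ofReal (1 / ν) + ENNReal.ofReal (9 / ν) := by
          rw [← ENNReal.ofReal_add (by positivity) (by positivity), ← ENNReal.ofReal_add (by positivity) (by positivity)]
          congr 1; ring
        rw [e]; ring
  have hfin : ∫⁻ r in A, U r ≠ ⊤ := by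
    have hsub : A ⊆ Metric.closedBall 0 (2 * D) := fun r hr => by
      rw [mem_closedBall_zero_iff]; exact hA2 r hr
    refine ne_top_of_le_ne_top ?_ (lintegral_mono_set hsub)
    have hc : ContinuousOn (fun r => ‖u r‖ ^ 2) (Metric.closedBall 0 (2 * D)) := by
      exact (hu.continuous.norm.pow 2).continuousOn
    have := hc.integrableOn_compact (μ := volume) (isCompact_closedBall 0 (2 * D))
    exact this.lintegral_lt_top.ne
  have h4 : ∫⁻ r in A, U r ≤ ENNReal.ofReal (30 * D ^ 2 / ν) * (∫⁻ r in A, V r) + ENNReal.ofReal (1 / 2) * ∫⁻ r in A, U r := by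
    calc _ ≤ _ := h1
      _ ≤ ENNReal.ofReal (2 * D ^ 2) * _ := mul_le_mul_right h3 _
      _ = _ := by
        rw [mul_add, ← mul_assoc, ← mul_assoc, ← ENNReal.ofReal_mul (by positivity), ← ENNReal.ofReal_mul (by positivity)]
        congr 3
        · ring_nf
        · field_simp; norm_num
  have h5 : (∫⁻ r in A, U r) = ENNReal.ofReal (1 / 2) * (∫⁻ r in A, U r) + ENNReal.ofReal (1 / 2) * ∫⁻ r in A, U r := by
    rw [← add_mul, ← ENNReal.ofReal_add (by norm_num) (by norm_num)]; norm_num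
  have h6 : ENNReal.ofReal (1 / 2) * (∫⁻ r in A, U r) ≤ ENNReal.ofReal (30 * D ^ 2 / ν) * (∫⁻ r in A, V r) := by
    have : ENNReal.ofReal (1 / 2) * (∫⁻ r in A, U r) + ENNReal.ofReal (1 / 2) * (∫⁻ r in A, U r) ≤ 
      ENNReal.ofReal (30 * D ^ 2 / ν) * (∫⁻ r in A, V r) + ENNReal.ofReal (1 / 2) * ∫⁻ r in A, U r := by
      rw [← h5]; exact h4
    exact (ENNReal.add_le_add_iff_right (ENNReal.mul_ne_top ENNReal.ofReal_ne_top hfin)).1 this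
  calc (∫⁻ r in A, U r) = ENNReal.ofReal 2 * (ENNReal.ofReal (1 / 2) * (∫⁻ r in A, U r)) := by
        rw [← mul_assoc, ← ENNReal.ofReal_mul (by norm_num)]; norm_num
    _ ≤ ENNReal.ofReal 2 * (ENNReal.ofReal (30 * D ^ 2 / ν) * (∫⁻ r in A, V r)) := mul_le_mul_right h6 _
    _ = _ := by
      rw [← mul_assoc, ← ENNReal.ofReal_mul (by norm_num)]; congr 2; ring
end core

/-- Identification of `ℂ` with the Euclidean plane. -/
def ltJ : ℂ ≃ₗᵢ[ℝ] E2 := Complex.orthonormalBasisOneI.repr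

lemma ltJ_zero (z : ℂ) : ltJ z 0 = z.re := by
  simp [ltJ]

lemma ltJ_one (z : ℂ) : ltJ z 1 = z.im := by
  simp [ltJ]

lemma ltJ_mp : MeasurePreserving ltJ volume volume := LinearIsometryEquiv.measurePreserving ltJ

lemma ltJ_lint (F : E2 → ENNReal) : ∫⁻ r : ℂ, F (ltJ r) = ∫⁻ x, F x :=
  ltJ_mp.lintegral_comp_emb ltJ.toHomeomorph.measurableEmbedding F

lemma lt_cov (G : E2 → E2 → ENNReal) (hG : Measurable (Function.uncurry G)) :
    ∫⁻ x, ∫⁻ y, G x y = ∫⁻ R, ∫⁻ r : ℂ, G (R + (1 / 2 : ℝ) • ltJ r) (R - (1 / 2 : ℝ) • ltJ r) := by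
  have hG' : ∀ {β : Type} [MeasurableSpace β] (f g : β → E2), Measurable f → Measurable g →
      Measurable (fun b => G (f b) (g b)) := fun f g hf hg => hG.comp (hf.prodMk hg)
  calc ∫⁻ x, ∫⁻ y, G x y = ∫⁻ y, ∫⁻ x, G x y := lintegral_lintegral_swap hG.aemeasurable
    _ = ∫⁻ y, ∫⁻ r, G (r + y) y := by
      congr 1; ext y
      exact (lintegral_add_right_eq_self (fun x => G x y) y).symm
    _ = ∫⁻ r, ∫⁻ y, G (r + y) y := by
      apply lintegral_lintegral_swap
      exact (hG' _ _ (by fun_prop) (by fun_prop)).aemeasurable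
    _ = ∫⁻ r, ∫⁻ R, G (R + (1 / 2 : ℝ) • r) (R - (1 / 2 : ℝ) • r) := by
      congr 1; ext r
      rw [← lintegral_sub_right_eq_self (fun y => G (r + y) y) ((1 / 2 : ℝ) • r)]
      congr 1; ext R
      congr 1
      have : r = (1 / 2 : ℝ) • r + (1 / 2 : ℝ) • r := by rw [← add_smul]; norm_num
      nth_rewrite 1 [this]
      abel
    _ = ∫⁻ R, ∫⁻ r, G (R + (1 / 2 : ℝ) • r) (R - (1 / 2 : ℝ) • r) := by
      apply lintegral_lintegral_swap
      exact (hG' _ _ (by fun_prop) (by fun_prop)).aemeasurable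
    _ = _ := by
      congr 1; ext R
      exact (ltJ_lint (fun r => G (R + (1 / 2 : ℝ) • r) (R - (1 / 2 : ℝ) • r))).symm

/-- Configuration with pair `j,k` at centre `R` and relative position `r`. -/
def ltY {N : ℕ} (j k : Fin N) (X : Fin N → E2) (R : E2) (r : ℂ) : Fin N → E2 :=
  Function.update (Function.update X k (R - (1 / 2 : ℝ) • ltJ r)) j (R + (1 / 2 : ℝ) • ltJ r)

lemma ltY_j {N : ℕ} (j k : Fin N) (X : Fin N → E2) (R : E2) (r : ℂ) :
    ltY j k X R r j = R + (1 / 2 : ℝ) • ltJ r := by simp [ltY]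

lemma ltY_k {N : ℕ} (j k : Fin N) (hjk : j ≠ k) (X : Fin N → E2) (R : E2) (r : ℂ) :
    ltY j k X R r k = R - (1 / 2 : ℝ) • ltJ r := by simp [ltY, Function.update_of_ne hjk.symm]

lemma ltY_l {N : ℕ} (j k l : Fin N) (hj : l ≠ j) (hk : l ≠ k) (X : Fin N → E2) (R : E2) (r : ℂ) :
    ltY j k X R r l = X l := by simp [ltY, Function.update_of_ne hj, Function.update_of_ne hk]

lemma lt_pair_reduce {N : ℕ} (j k : Fin N) (hjk : j ≠ k) (f g : (Fin N → E2) → ENNReal)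
    (hf : Measurable f) (hg : Measurable g)
    (h : ∀ X R, ∫⁻ r : ℂ, f (ltY j k X R r) ≤ ∫⁻ r : ℂ, g (ltY j k X R r)) :
    ∫⁻ X, f X ≤ ∫⁻ X, g X := by
  rw [volume_pi]
  have e : ∀ F : (Fin N → E2) → ENNReal, Measurable F → ∀ X, (∫⋯∫⁻_{j, k}, F ∂(fun _ : Fin N => (volume : Measure E2))) X
      = ∫⁻ R, ∫⁻ r : ℂ, F (ltY j k X R r) := by
    intro F hF X
    rw [lmarginal_insert _ hF (by simpa using hjk)]
    simp_rw [lmarginal_singleton]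
    unfold ltY
    rw [← lt_cov (fun x y => F (Function.update (Function.update X k y) j x))]
    · congr 1; ext x; congr 1; ext y; congr 1
      exact Function.update_comm hjk _ _ _
    · apply hF.comp
      rw [measurable_pi_iff]
      intro l
      by_cases hlj : l = j
      · subst hlj; simp; fun_prop
      · by_cases hlk : l = k
        · subst hlk; simp [Function.update_of_ne hlj]; fun_prop
        · simp [Function.update_of_ne hlj, Function.update_of_ne hlk]
  apply lintegral_le_of_lmarginal_le {j, k} hf hg
  intro X
  rw [e f hf, e g hg]
  exact lintegral_mono (fun R => h X R)

/-- `k` is the (tie-broken) nearest neighbour of `j`. -/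
def ltA {N : ℕ} (j k : Fin N) : Set (Fin N → E2) :=
  {X | X j ≠ X k ∧ ∀ l, l ≠ j → l ≠ k →
    ‖X j - X k‖ ≤ ‖X j - X l‖ ∧ (l < k → ‖X j - X k‖ < ‖X j - X l‖)}

/-- Distance of the other particles from the centre of the pair. -/
def ltD {N : ℕ} (j k : Fin N) (X : Fin N → E2) : ℝ :=
  ⨅ l : {l : Fin N // l ≠ j ∧ l ≠ k}, ‖X l - (1 / 2 : ℝ) • (X j + X k)‖

/-- Kinetic energy density of particle `j`. -/
def ltT {N : ℕ} (α : ℝ) (Ψ : (Fin N → E2) → ℂ) (j : Fin N) (X : Fin N → E2) : ℝ :=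
  ∑ c : Fin 2, ‖covDIdeal α Ψ j X c‖ ^ 2

lemma lt_meas_A {N : ℕ} (j k : Fin N) : MeasurableSet (ltA j k) := by
  have : ltA j k = {X | X j = X k}ᶜ ∩ ⋂ l, ⋂ (_ : l ≠ j), ⋂ (_ : l ≠ k),
      ({X : Fin N → E2 | ‖X j - X k‖ ≤ ‖X j - X l‖} ∩ ⋂ (_ : l < k), {X | ‖X j - X k‖ < ‖X j - X l‖}) := by
    ext X; simp [ltA]
  rw [this]
  refine MeasurableSet.inter (measurableSet_eq_fun (by fun_prop) (by fun_prop)).compl ?_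
  refine MeasurableSet.iInter fun l => MeasurableSet.iInter fun _ => MeasurableSet.iInter fun _ => ?_
  refine MeasurableSet.inter (measurableSet_le (by fun_prop) (by fun_prop)) ?_
  exact MeasurableSet.iInter fun _ => measurableSet_lt (by fun_prop) (by fun_prop)

lemma lt_meas_D {N : ℕ} (j k : Fin N) : Measurable (ltD (N := N) j k) := by
  unfold ltD
  apply Measurable.iInf
  intro l
  fun_prop

lemma lt_Avec_zero {N : ℕ} (X : Fin N → E2) (j : Fin N) :
    AvecIdeal X j 0 = ∑ k ∈ Finset.univ.erase j, (‖X j - X k‖ ^ 2)⁻¹ * (-(X j - X k) 1) := by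
  simp [AvecIdeal, perp]

lemma lt_Avec_one {N : ℕ} (X : Fin N → E2) (j : Fin N) :
    AvecIdeal X j 1 = ∑ k ∈ Finset.univ.erase j, (‖X j - X k‖ ^ 2)⁻¹ * ((X j - X k) 0) := by
  simp [AvecIdeal, perp]

lemma lt_meas_Avec {N : ℕ} (j : Fin N) (c : Fin 2) : Measurable (fun X : Fin N → E2 => AvecIdeal X j c) := by
  fin_cases c
  · simp only [Fin.zero_eta, lt_Avec_zero]; fun_prop
  · simp only [Fin.mk_one, lt_Avec_one]; fun_prop

lemma lt_meas_cov {N : ℕ} (α : ℝ) (Ψ : (Fin N → E2) → ℂ) (hΨ : ContDiff ℝ 1 Ψ) (j : Fin N) (c : Fin 2) :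
    Measurable (fun X => covDIdeal α Ψ j X c) := by
  unfold covDIdeal
  have h1 : Measurable (fun X => fderiv ℝ Ψ X (dirv N j c)) :=
    ((hΨ.continuous_fderiv (by norm_num)).clm_apply continuous_const).measurable
  have h2 := lt_meas_Avec j c
  have h3 := hΨ.continuous.measurable
  exact (h1.const_mul _).add ((Complex.measurable_ofReal.comp (h2.const_mul α)).mul h3)

lemma lt_meas_T {N : ℕ} (α : ℝ) (Ψ : (Fin N → E2) → ℂ) (hΨ : ContDiff ℝ 1 Ψ) (j : Fin N) :
    Measurable (ltT α Ψ j) := by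
  unfold ltT
  have := lt_meas_cov α Ψ hΨ j
  fun_prop

lemma lt_T_nonneg {N : ℕ} (α : ℝ) (Ψ : (Fin N → E2) → ℂ) (j : Fin N) (X) : 0 ≤ ltT α Ψ j X := by
  unfold ltT; positivity

lemma lt_fderiv_eq {N : ℕ} (α : ℝ) (Ψ : (Fin N → E2) → ℂ) (j : Fin N) (X : Fin N → E2) (c : Fin 2) :
    fderiv ℝ Ψ X (dirv N j c) = Complex.I * covDIdeal α Ψ j X c
      - Complex.I * ((α * AvecIdeal X j c : ℝ) : ℂ) * Ψ X := by
  unfold covDIdeal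
  have : Complex.I * Complex.I = -1 := Complex.I_mul_I
  linear_combination (fderiv ℝ Ψ X (dirv N j c)) * this

lemma ltY_aff {N : ℕ} (j k : Fin N) (hjk : j ≠ k) (X : Fin N → E2) (R : E2) (r : ℂ) :
    ltY j k X R r = ltY j k X R 0 + ((r.re / 2) • (dirv N j 0 - dirv N k 0) + (r.im / 2) • (dirv N j 1 - dirv N k 1)) := by
  funext l
  by_cases hlj : l = j
  · subst hlj
    ext c
    fin_cases c <;> simp [ltY_j, dirv, Function.update_of_ne hjk, basisVec, ltJ_zero, ltJ_one] <;> ring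
  · by_cases hlk : l = k
    · subst hlk
      ext c
      fin_cases c <;> simp [ltY_k _ _ hjk, dirv, Function.update_of_ne hjk.symm, basisVec, ltJ_zero, ltJ_one] <;> ring
    · simp [ltY_l _ _ _ hlj hlk, dirv, Function.update_of_ne hlj, Function.update_of_ne hlk]

lemma ltY_hasFDeriv {N : ℕ} (j k : Fin N) (hjk : j ≠ k) (X : Fin N → E2) (R : E2) (r : ℂ) :
    HasFDerivAt (ltY j k X R)
      (((1 / 2 : ℝ) • Complex.reCLM).smulRight (dirv N j 0 - dirv N k 0) + ((1 / 2 : ℝ) • Complex.imCLM).smulRight (dirv N j 1 - dirv N k 1)) r := by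
  have : ltY j k X R = fun r => ltY j k X R 0 + (((1 / 2 : ℝ) • Complex.reCLM).smulRight (dirv N j 0 - dirv N k 0) + ((1 / 2 : ℝ) • Complex.imCLM).smulRight (dirv N j 1 - dirv N k 1)) r := by
    funext r
    rw [ltY_aff j k hjk]
    simp
    congr 2 <;> ring
  rw [this]
  exact (ContinuousLinearMap.hasFDerivAt _).const_add _

lemma ltY_contDiff {N : ℕ} (j k : Fin N) (hjk : j ≠ k) (X : Fin N → E2) (R : E2) :
    ContDiff ℝ 1 (ltY j k X R) := by
  have : ltY j k X R = fun r => ltY j k X R 0 + (((1 / 2 : ℝ) • Complex.reCLM).smulRight (dirv N j 0 - dirv N k 0) + ((1 / 2 : ℝ) • Complex.imCLM).smulRight (dirv N j 1 - dirv N k 1)) r := by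
    funext r
    rw [ltY_aff j k hjk]
    simp
    congr 2 <;> ring
  rw [this]
  exact contDiff_const.add (ContinuousLinearMap.contDiff _)

lemma ltY_neg {N : ℕ} (j k : Fin N) (hjk : j ≠ k) (X : Fin N → E2) (R : E2) (r : ℂ) :
    ltY j k X R (-r) = ltY j k X R r ∘ (Equiv.swap j k) := by
  funext l
  simp only [Function.comp]
  by_cases hlj : l = j
  · subst hlj
    rw [Equiv.swap_apply_left, ltY_j, ltY_k _ _ hjk, map_neg, smul_neg, sub_eq_add_neg]
  · by_cases hlk : l = k
    · subst hlk
      rw [Equiv.swap_apply_right, ltY_j, ltY_k _ _ hjk, map_neg, smul_neg, sub_neg_eq_add]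
    · rw [Equiv.swap_apply_of_ne_of_ne hlj hlk, ltY_l _ _ _ hlj hlk, ltY_l _ _ _ hlj hlk]

lemma lt_odd {N : ℕ} (Ψ : (Fin N → E2) → ℂ) (hanti : Antisym N Ψ) (j k : Fin N) (hjk : j ≠ k) (X : Fin N → E2) (R : E2) (r : ℂ) :
    Ψ (ltY j k X R (-r)) = - Ψ (ltY j k X R r) := by
  rw [ltY_neg j k hjk, hanti, Equiv.Perm.sign_swap hjk]; simp

/-- The two-dimensional kernel. -/
lemma lt_kernel (q w : ℂ) : (q / w).re = (‖w‖ ^ 2)⁻¹ * (w.re * q.re + w.im * q.im) := by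
  rw [Complex.div_re, Complex.sq_norm]; ring

lemma lt_normJ (x : E2) (w : ℂ) (h : x = ltJ w) : ‖x‖ = ‖w‖ ∧ x 0 = w.re ∧ x 1 = w.im := by
  subst h
  exact ⟨ltJ.norm_map w, ltJ_zero w, ltJ_one w⟩

lemma lt_erase_sum {N : ℕ} (j k : Fin N) (hjk : j ≠ k) (f : Fin N → ℝ) :
    ∑ l ∈ Finset.univ.erase j, f l = f k + ∑ l : {l : Fin N // l ≠ j ∧ l ≠ k}, f l := by
  have h : k ∈ Finset.univ.erase j := by simp [hjk.symm]
  rw [← Finset.add_sum_erase _ _ h]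
  congr 1
  apply Finset.sum_subtype
  intro l; simp [and_comm]

lemma lt_gauge {N : ℕ} (j k : Fin N) (hjk : j ≠ k) (X : Fin N → E2) (R : E2) (r : ℂ) (hr : 0 < ‖r‖) :
    (1 / 2 * (AvecIdeal (ltY j k X R r) j 0 - AvecIdeal (ltY j k X R r) k 0)) * (Complex.I * r).re
    + (1 / 2 * (AvecIdeal (ltY j k X R r) j 1 - AvecIdeal (ltY j k X R r) k 1)) * (Complex.I * r).im
    = 1 + ∑ l : {l : Fin N // l ≠ j ∧ l ≠ k}, ((r / 2) / (r / 2 - ltJ.symm (X l - R)) + (r / 2) / (r / 2 + ltJ.symm (X l - R))).re := by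
  have hJ : ltJ r = (1 / 2 : ℝ) • ltJ r + (1 / 2 : ℝ) • ltJ r := by rw [← add_smul]; norm_num
  have hr2 : r.re ^ 2 + r.im ^ 2 = ‖r‖ ^ 2 := by rw [Complex.sq_norm, Complex.normSq_apply]; ring
  have hrn : ‖r‖ ^ 2 ≠ 0 := by positivity
  have sm : (1 / 2 : ℝ) • ltJ r = ltJ (r / 2) := by
    rw [← map_smul]; congr 1; rw [Complex.real_smul]; push_cast; ring
  rw [lt_Avec_zero, lt_Avec_one, lt_Avec_zero, lt_Avec_one, lt_erase_sum j k hjk, lt_erase_sum j k hjk]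
  have sk : ∀ f : Fin N → ℝ, ∑ l ∈ Finset.univ.erase k, f l = f j + ∑ l : {l : Fin N // l ≠ j ∧ l ≠ k}, f l := by
    intro f
    have h : j ∈ Finset.univ.erase k := by simp [hjk]
    rw [← Finset.add_sum_erase _ _ h]
    congr 1
    apply Finset.sum_subtype
    intro l; simp
  rw [sk, sk]
  obtain ⟨a1, a2, a3⟩ := lt_normJ (ltY j k X R r j - ltY j k X R r k) r (by
    rw [ltY_j, ltY_k _ _ hjk]; rw (occs := .pos [3]) [hJ]; abel)
  obtain ⟨b1, b2, b3⟩ := lt_normJ (ltY j k X R r k - ltY j k X R r j) (-r) (by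
    rw [ltY_j, ltY_k _ _ hjk, map_neg]; rw (occs := .pos [3]) [hJ]; abel)
  rw [a1, a2, a3, b1, b2, b3, norm_neg]
  have cj : ∀ l : {l : Fin N // l ≠ j ∧ l ≠ k}, ‖ltY j k X R r j - ltY j k X R r l‖ = ‖r / 2 - ltJ.symm (X l - R)‖ ∧
      (ltY j k X R r j - ltY j k X R r l) 0 = (r / 2 - ltJ.symm (X l - R)).re ∧
      (ltY j k X R r j - ltY j k X R r l) 1 = (r / 2 - ltJ.symm (X l - R)).im := by
    intro l
    apply lt_normJ
    rw [ltY_j, ltY_l _ _ _ l.2.1 l.2.2, map_sub, LinearIsometryEquiv.apply_symm_apply, sm]; abel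
  have ck : ∀ l : {l : Fin N // l ≠ j ∧ l ≠ k}, ‖ltY j k X R r k - ltY j k X R r l‖ = ‖-(r / 2 + ltJ.symm (X l - R))‖ ∧
      (ltY j k X R r k - ltY j k X R r l) 0 = (-(r / 2 + ltJ.symm (X l - R))).re ∧
      (ltY j k X R r k - ltY j k X R r l) 1 = (-(r / 2 + ltJ.symm (X l - R))).im := by
    intro l
    apply lt_normJ
    rw [ltY_k _ _ hjk, ltY_l _ _ _ l.2.1 l.2.2, map_neg, map_add, LinearIsometryEquiv.apply_symm_apply, sm]; abel
  simp_rw [fun l => (cj l).1, fun l => (cj l).2.1, fun l => (cj l).2.2, fun l => (ck l).1, fun l => (ck l).2.1, fun l => (ck l).2.2, norm_neg]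
  simp_rw [Complex.add_re, lt_kernel (r / 2)]
  have e1 : (Complex.I * r).re = - r.im := by simp
  have e2 : (Complex.I * r).im = r.re := by simp
  rw [e1, e2, Finset.sum_add_distrib]
  have d1 : (r / 2).re = r.re / 2 := by simp
  have d2 : (r / 2).im = r.im / 2 := by simp
  set S1 := Finset.univ (α := {l : Fin N // l ≠ j ∧ l ≠ k})
  have f1 : ∑ l ∈ S1, (‖r / 2 - ltJ.symm (X l - R)‖ ^ 2)⁻¹ * ((r / 2 - ltJ.symm (X l - R)).re * (r / 2).re + (r / 2 - ltJ.symm (X l - R)).im * (r / 2).im)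
    = 1 / 2 * (r.re * (∑ l ∈ S1, (‖r / 2 - ltJ.symm (X l - R)‖ ^ 2)⁻¹ * (r / 2 - ltJ.symm (X l - R)).re)
      - r.im * (∑ l ∈ S1, (‖r / 2 - ltJ.symm (X l - R)‖ ^ 2)⁻¹ * -(r / 2 - ltJ.symm (X l - R)).im)) := by
    rw [Finset.mul_sum, Finset.mul_sum, ← Finset.sum_sub_distrib, Finset.mul_sum]
    apply Finset.sum_congr rfl; intro l _
    rw [d1, d2]; ring
  have f2 : ∑ l ∈ S1, (‖r / 2 + ltJ.symm (X l - R)‖ ^ 2)⁻¹ * ((r / 2 + ltJ.symm (X l - R)).re * (r / 2).re + (r / 2 + ltJ.symm (X l - R)).im * (r / 2).im)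
    = 1 / 2 * (-(r.re * (∑ l ∈ S1, (‖r / 2 + ltJ.symm (X l - R)‖ ^ 2)⁻¹ * (-(r / 2 + ltJ.symm (X l - R))).re))
      + r.im * (∑ l ∈ S1, (‖r / 2 + ltJ.symm (X l - R)‖ ^ 2)⁻¹ * -(-(r / 2 + ltJ.symm (X l - R))).im)) := by
    rw [Finset.mul_sum, Finset.mul_sum, ← Finset.sum_neg_distrib, ← Finset.sum_add_distrib, Finset.mul_sum]
    apply Finset.sum_congr rfl; intro l _
    rw [d1, d2, Complex.neg_re, Complex.neg_im]; ring
  rw [f1, f2]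
  have g : (‖r‖ ^ 2)⁻¹ * (r.re ^ 2 + r.im ^ 2) = 1 := by rw [hr2]; exact inv_mul_cancel₀ hrn
  rw [Complex.neg_re, Complex.neg_im] 
  linear_combination g

lemma lt_half_sq (p q : ℂ) : ‖(1 / 2 : ℂ) * (p - q)‖ ^ 2 ≤ 1 / 2 * (‖p‖ ^ 2 + ‖q‖ ^ 2) := by
  have h : ‖(1 / 2 : ℂ) * (p - q)‖ ≤ 1 / 2 * (‖p‖ + ‖q‖) := by
    rw [norm_mul]
    have : ‖(1 / 2 : ℂ)‖ = 1 / 2 := by norm_num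
    rw [this]
    gcongr
    exact norm_sub_le _ _
  calc _ ≤ (1 / 2 * (‖p‖ + ‖q‖)) ^ 2 := by gcongr
    _ ≤ _ := by nlinarith [sq_nonneg (‖p‖ - ‖q‖)]

lemma ltY_sub {N : ℕ} (j k : Fin N) (hjk : j ≠ k) (X : Fin N → E2) (R : E2) (r : ℂ) :
    ‖ltY j k X R r j - ltY j k X R r k‖ = ‖r‖ := by
  rw [ltY_j, ltY_k _ _ hjk]
  have hJ : ltJ r = (1 / 2 : ℝ) • ltJ r + (1 / 2 : ℝ) • ltJ r := by rw [← add_smul]; norm_num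
  have : R + (1 / 2 : ℝ) • ltJ r - (R - (1 / 2 : ℝ) • ltJ r) = ltJ r := by
    rw (occs := .pos [3]) [hJ]; abel
  rw [this, ltJ.norm_map]

lemma ltY_subl {N : ℕ} (j k l : Fin N) (hj : l ≠ j) (hk : l ≠ k) (X : Fin N → E2) (R : E2) (r : ℂ) :
    ‖ltY j k X R r j - ltY j k X R r l‖ = ‖r / 2 - ltJ.symm (X l - R)‖ := by
  rw [ltY_j, ltY_l _ _ _ hj hk, ← ltJ.norm_map (r / 2 - ltJ.symm (X l - R)), map_sub, LinearIsometryEquiv.apply_symm_apply]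
  have sm : (1 / 2 : ℝ) • ltJ r = ltJ (r / 2) := by
    rw [← map_smul]; congr 1; rw [Complex.real_smul]; push_cast; ring
  rw [sm]; congr 1; abel

lemma ltY_mem {N : ℕ} (j k : Fin N) (hjk : j ≠ k) (X : Fin N → E2) (R : E2) (r : ℂ) :
    ltY j k X R r ∈ ltA j k ↔ r ≠ 0 ∧ ∀ l, l ≠ j → l ≠ k → ‖r‖ ≤ ‖r / 2 - ltJ.symm (X l - R)‖ ∧
      (l < k → ‖r‖ < ‖r / 2 - ltJ.symm (X l - R)‖) := by
  simp only [ltA, Set.mem_ofPred_eq]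
  rw [← sub_ne_zero, ← norm_ne_zero_iff, ltY_sub _ _ hjk, norm_ne_zero_iff]
  refine and_congr Iff.rfl (forall_congr' fun l => forall_congr' fun hj => forall_congr' fun hk => ?_)
  rw [ltY_subl _ _ _ hj hk]

lemma ltY_D {N : ℕ} (j k : Fin N) (hjk : j ≠ k) (X : Fin N → E2) (R : E2) (r : ℂ) :
    ltD j k (ltY j k X R r) = ⨅ l : {l : Fin N // l ≠ j ∧ l ≠ k}, ‖ltJ.symm (X l - R)‖ := by
  unfold ltD
  congr 1; funext l
  rw [ltY_l _ _ _ l.2.1 l.2.2, ltJ.symm.norm_map, ltY_j, ltY_k _ _ hjk]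
  congr 2
  rw [show R + (1 / 2 : ℝ) • ltJ r + (R - (1 / 2 : ℝ) • ltJ r) = (2 : ℝ) • R by rw [two_smul]; abel, smul_smul]
  norm_num

/-- The weight of a pair. -/
def ltF {N : ℕ} (Ψ : (Fin N → E2) → ℂ) (j k : Fin N) (X : Fin N → E2) : ENNReal :=
  (ltA j k).indicator (fun X => ENNReal.ofReal (1 / ltD j k X ^ 2) * ENNReal.ofReal (‖Ψ X‖ ^ 2)) X

/-- The energy of a pair. -/
def ltG {N : ℕ} (α : ℝ) (Ψ : (Fin N → E2) → ℂ) (j k : Fin N) (X : Fin N → E2) : ENNReal :=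
  (ltA j k).indicator (fun X => ENNReal.ofReal (ltT α Ψ j X + ltT α Ψ k X)) X

lemma lt_meas_F {N : ℕ} (Ψ : (Fin N → E2) → ℂ) (hΨ : ContDiff ℝ 1 Ψ) (j k : Fin N) :
    Measurable (ltF Ψ j k) := by
  unfold ltF
  have h1 := lt_meas_D (N := N) j k
  have h2 := hΨ.continuous.measurable
  exact Measurable.indicator (by fun_prop) (lt_meas_A j k)

lemma lt_meas_G {N : ℕ} (α : ℝ) (Ψ : (Fin N → E2) → ℂ) (hΨ : ContDiff ℝ 1 Ψ) (j k : Fin N) :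
    Measurable (ltG α Ψ j k) := by
  unfold ltG
  have h1 := lt_meas_T α Ψ hΨ j
  have h2 := lt_meas_T α Ψ hΨ k
  exact Measurable.indicator (by fun_prop) (lt_meas_A j k)

lemma lt_pair {N : ℕ} (α : ℝ) (hα : α ∈ Set.Icc (0 : ℝ) 2) (hα1 : α ≠ 1) (Ψ : (Fin N → E2) → ℂ)
    (hΨ : ContDiff ℝ 1 Ψ) (hanti : Antisym N Ψ) (j k : Fin N) (hjk : j ≠ k) :
    ∫⁻ X, ltF Ψ j k X ≤ ENNReal.ofReal (30 / |1 - α|) * ∫⁻ X, ltG α Ψ j k X := by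
  rw [← lintegral_const_mul _ (lt_meas_G α Ψ hΨ j k)]
  apply lt_pair_reduce j k hjk _ _ (lt_meas_F Ψ hΨ j k) ((lt_meas_G α Ψ hΨ j k).const_mul _)
  intro X R
  set Y := ltY j k X R with hY
  have hYc : ContDiff ℝ 1 Y := ltY_contDiff j k hjk X R
  have hYm : Measurable Y := hYc.continuous.measurable
  set D := ⨅ l : {l : Fin N // l ≠ j ∧ l ≠ k}, ‖ltJ.symm (X l - R)‖ with hD
  have hDY : ∀ r, ltD j k (Y r) = D := fun r => ltY_D j k hjk X R r
  have hν0 : 0 < |1 - α| := abs_pos.2 (sub_ne_zero.2 (Ne.symm hα1))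
  by_cases hD0 : D = 0
  · have : ∀ r, ltF Ψ j k (Y r) = 0 := by
      intro r
      simp [ltF, hDY, hD0, Set.indicator]
    simp [this]
  have hDnn : 0 ≤ D := Real.iInf_nonneg fun l => norm_nonneg _
  have hDpos : 0 < D := lt_of_le_of_ne hDnn (Ne.symm hD0)
  have hne : Nonempty {l : Fin N // l ≠ j ∧ l ≠ k} := by
    by_contra h
    rw [not_nonempty_iff] at h
    exact hD0 (Real.iInf_of_isEmpty _)
  have hDl : ∀ l : {l : Fin N // l ≠ j ∧ l ≠ k}, D ≤ ‖ltJ.symm (X l - R)‖ := fun l =>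
    ciInf_le ⟨0, by rintro _ ⟨l, rfl⟩; exact norm_nonneg _⟩ l
  set A : Set ℂ := Y ⁻¹' (ltA j k) with hAdef
  have hAm : MeasurableSet A := hYm (lt_meas_A j k)
  have hmem : ∀ r, r ∈ A ↔ _ := fun r => ltY_mem j k hjk X R r
  have hcovm := fun (i : Fin N) (c : Fin 2) => (lt_meas_cov α Ψ hΨ i c).comp hYm
  have core := lt_core α hα hα1 (fun l : {l : Fin N // l ≠ j ∧ l ≠ k} => ltJ.symm (X l - R)) D hDpos hDl
    (fun r => Ψ (Y r)) (fun r => (1 / 2 : ℂ) * (covDIdeal α Ψ j (Y r) 0 - covDIdeal α Ψ k (Y r) 0))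
    (fun r => (1 / 2 : ℂ) * (covDIdeal α Ψ j (Y r) 1 - covDIdeal α Ψ k (Y r) 1))
    (fun r => ⟨1 / 2 * (AvecIdeal (Y r) j 0 - AvecIdeal (Y r) k 0), 1 / 2 * (AvecIdeal (Y r) j 1 - AvecIdeal (Y r) k 1)⟩)
    (hΨ.comp hYc) (lt_odd Ψ hanti j k hjk X R)
    (((hcovm j 0).sub (hcovm k 0)).const_mul _) (((hcovm j 1).sub (hcovm k 1)).const_mul _) ?_
    (fun r hr _ => lt_gauge j k hjk X R r hr) A hAm ?_ ?_ ?_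
  · have e1 : ∫⁻ r, ltF Ψ j k (Y r) = ENNReal.ofReal (1 / D ^ 2) * ∫⁻ r in A, ENNReal.ofReal (‖Ψ (Y r)‖ ^ 2) := by
      rw [← lintegral_const_mul' _ _ ENNReal.ofReal_ne_top, ← lintegral_indicator hAm]
      congr 1; funext r
      simp only [ltF, Set.indicator, hDY]
      rfl
    have e2 : ∫⁻ r, ENNReal.ofReal (30 / |1 - α|) * ltG α Ψ j k (Y r)
        = ENNReal.ofReal (30 / |1 - α|) * ∫⁻ r in A, ENNReal.ofReal (ltT α Ψ j (Y r) + ltT α Ψ k (Y r)) := by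
      rw [lintegral_const_mul' _ _ ENNReal.ofReal_ne_top, ← lintegral_indicator hAm]
      rfl
    rw [e1, e2]
    calc _ ≤ ENNReal.ofReal (1 / D ^ 2) * (ENNReal.ofReal (60 * D ^ 2 / |1 - α|) * ∫⁻ r in A, ENNReal.ofReal (1 / 2 * (ltT α Ψ j (Y r) + ltT α Ψ k (Y r)))) := by
          refine mul_le_mul_right (core.trans (mul_le_mul_right (lintegral_mono ?_) _)) _
          intro r
          apply ENNReal.ofReal_le_ofReal
          have h1 := lt_half_sq (covDIdeal α Ψ j (Y r) 0) (covDIdeal α Ψ k (Y r) 0)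
          have h2 := lt_half_sq (covDIdeal α Ψ j (Y r) 1) (covDIdeal α Ψ k (Y r) 1)
          simp only [ltT, Fin.sum_univ_two]
          linarith
      _ = ENNReal.ofReal (1 / D ^ 2) * (ENNReal.ofReal (60 * D ^ 2 / |1 - α|) * (ENNReal.ofReal (1 / 2) * ∫⁻ r in A, ENNReal.ofReal (ltT α Ψ j (Y r) + ltT α Ψ k (Y r)))) := by
          rw [← lintegral_const_mul' (ENNReal.ofReal (1 / 2)) _ ENNReal.ofReal_ne_top]
          simp_rw [ENNReal.ofReal_mul (show (0:ℝ) ≤ 1 / 2 by norm_num)]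
      _ = _ := by
          rw [← mul_assoc, ← mul_assoc, ← ENNReal.ofReal_mul (by positivity), ← ENNReal.ofReal_mul (by positivity)]
          congr 2
          field_simp
          norm_num
  · intro r v
    have h1 : HasFDerivAt (fun r => Ψ (Y r)) _ r :=
      ((hΨ.differentiable (by norm_num)) (Y r)).hasFDerivAt.comp r (ltY_hasFDeriv j k hjk X R r)
    rw [h1.fderiv]
    simp only [ContinuousLinearMap.comp_apply, add_apply, ContinuousLinearMap.smulRight_apply,
      smul_apply, Complex.reCLM_apply, Complex.imCLM_apply, map_add, map_smul, map_sub, lt_fderiv_eq α,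
      Complex.real_smul, smul_eq_mul]
    push_cast
    ring
  · intro r hr l hl0 hl1
    rw [hmem] at hr ⊢
    obtain ⟨hr0, hr⟩ := hr
    have hrp : 0 < ‖r‖ := norm_pos_iff.2 hr0
    have hln : ‖(l : ℂ)‖ = l := by rw [Complex.norm_real, Real.norm_of_nonneg hl0.le]
    refine ⟨mul_ne_zero (by exact_mod_cast hl0.ne') hr0, fun i hj hk => ?_⟩
    suffices h : ‖(l : ℂ) * r‖ < ‖(l : ℂ) * r / 2 - ltJ.symm (X i - R)‖ from ⟨h.le, fun _ => h⟩
    have h1 := (hr i hj hk).1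
    have h2 : ‖r / 2 - ltJ.symm (X i - R)‖ ≤ ‖(l : ℂ) * r / 2 - ltJ.symm (X i - R)‖ + (1 - l) * ‖r‖ / 2 := by
      have e : r / 2 - ltJ.symm (X i - R) = ((l : ℂ) * r / 2 - ltJ.symm (X i - R)) + ((1 - l : ℝ) : ℂ) * r / 2 := by
        push_cast; ring
      rw [e]
      refine (norm_add_le _ _).trans ?_
      gcongr
      rw [norm_div, norm_mul, Complex.norm_real, Real.norm_of_nonneg (by linarith)]
      norm_num
    rw [norm_mul, hln]
    nlinarith
  · intro r hr0 hr
    rw [hmem]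
    refine ⟨norm_pos_iff.1 hr0, fun i hj hk => ?_⟩
    suffices h : ‖r‖ < ‖r / 2 - ltJ.symm (X i - R)‖ from ⟨h.le, fun _ => h⟩
    have h1 := hDl ⟨i, hj, hk⟩
    have h2 := norm_sub_norm_le (ltJ.symm (X i - R)) (r / 2)
    rw [norm_sub_rev, norm_div, Complex.norm_two] at h2
    simp only at h1
    linarith
  · intro r hr
    rw [hmem] at hr
    obtain ⟨hr0, hr⟩ := hr
    have : ‖r‖ / 2 ≤ D := by
      apply le_ciInf
      intro l
      have h1 := (hr l l.2.1 l.2.2).1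
      have h2 := norm_sub_le (r / 2) (ltJ.symm (X l - R))
      rw [norm_div, Complex.norm_two] at h2
      linarith
    linarith

lemma lt_normsq (x : E2) : ‖x‖ ^ 2 = x 0 ^ 2 + x 1 ^ 2 := by
  rw [EuclideanSpace.norm_sq_eq]; simp

lemma lt_octant (v0 v1 w0 w1 : ℝ) (h0 : 0 ≤ v0 * w0) (h1 : 0 ≤ v1 * w1)
    (h2 : (|v0| ≤ |v1| ∧ |w0| ≤ |w1|) ∨ (|v1| ≤ |v0| ∧ |w1| ≤ |w0|))
    (hv : v0 ^ 2 + v1 ^ 2 ≤ (v0 - w0) ^ 2 + (v1 - w1) ^ 2)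
    (hw : w0 ^ 2 + w1 ^ 2 ≤ (v0 - w0) ^ 2 + (v1 - w1) ^ 2)
    (hv0 : 0 < v0 ^ 2 + v1 ^ 2) (hw0 : 0 < w0 ^ 2 + w1 ^ 2) : False := by
  set d := v0 * w0 + v1 * w1 with hd
  have hd0 : 0 ≤ d := by positivity
  have e1 : 2 * d ≤ v0 ^ 2 + v1 ^ 2 := by nlinarith
  have e2 : 2 * d ≤ w0 ^ 2 + w1 ^ 2 := by nlinarith
  have e3 : (2 * d) * (2 * d) ≤ (v0 ^ 2 + v1 ^ 2) * (w0 ^ 2 + w1 ^ 2) := by gcongr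
  have e4 : (v0 ^ 2 + v1 ^ 2) * (w0 ^ 2 + w1 ^ 2) = d ^ 2 + (v0 * w1 - v1 * w0) ^ 2 := by rw [hd]; ring
  have e5 : |v0 * w1 - v1 * w0| ≤ d := by
    have a0 : v0 * w0 = |v0| * |w0| := by rw [← abs_mul, abs_of_nonneg h0]
    have a1 : v1 * w1 = |v1| * |w1| := by rw [← abs_mul, abs_of_nonneg h1]
    have : (v0 * w1 - v1 * w0) ^ 2 = (|v0| * |w1| - |v1| * |w0|) ^ 2 := by
      have s0 := sq_abs v0
      have s1 := sq_abs v1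
      have s2 := sq_abs w0
      have s3 := sq_abs w1
      calc _ = v0 ^ 2 * w1 ^ 2 + v1 ^ 2 * w0 ^ 2 - 2 * (v0 * w0) * (v1 * w1) := by ring
        _ = |v0| ^ 2 * |w1| ^ 2 + |v1| ^ 2 * |w0| ^ 2 - 2 * (|v0| * |w0|) * (|v1| * |w1|) := by rw [s0, s1, s2, s3, a0, a1]
        _ = _ := by ring
    rw [← abs_of_nonneg hd0]
    rw [← sq_le_sq, this, sq_le_sq, abs_of_nonneg hd0, abs_le, hd, a0, a1]
    have p0 := abs_nonneg v0
    have p1 := abs_nonneg v1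
    have p2 := abs_nonneg w0
    have p3 := abs_nonneg w1
    rcases h2 with ⟨h2, h3⟩ | ⟨h2, h3⟩
    · have f1 := mul_le_mul_of_nonneg_right h2 p3
      have f2 := mul_le_mul_of_nonneg_left h3 p1
      have f3 := mul_nonneg p0 p2
      have f4 := mul_nonneg p0 p3
      have f5 := mul_nonneg p1 p2
      constructor <;> linarith
    · have f1 := mul_le_mul_of_nonneg_right h2 p2
      have f2 := mul_le_mul_of_nonneg_left h3 p0
      have f3 := mul_nonneg p1 p3
      have f4 := mul_nonneg p0 p3
      have f5 := mul_nonneg p1 p2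
      constructor <;> linarith
  have e6 : (v0 * w1 - v1 * w0) ^ 2 ≤ d ^ 2 := by
    rw [sq_le_sq, abs_of_nonneg hd0]; exact e5
  have e7 : 0 < (v0 ^ 2 + v1 ^ 2) * (w0 ^ 2 + w1 ^ 2) := by positivity
  nlinarith

lemma lt_A_ne {N : ℕ} {j k : Fin N} {X : Fin N → E2} (h : X ∈ ltA j k) : j ≠ k := by
  rintro rfl; exact h.1 rfl

open Classical in
lemma lt_card_k {N : ℕ} (j : Fin N) (X : Fin N → E2) :
    (Finset.univ.filter (fun k => X ∈ ltA j k)).card ≤ 1 := by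
  rw [Finset.card_le_one]
  have key : ∀ a b : Fin N, a < b → X ∈ ltA j a → X ∈ ltA j b → False := by
    intro a b hab ha hb
    have h1 := (hb.2 a (lt_A_ne ha).symm hab.ne).2 hab
    have h2 := (ha.2 b (lt_A_ne hb).symm hab.ne').1
    linarith
  intro a ha b hb
  simp only [Finset.mem_filter, Finset.mem_univ, true_and] at ha hb
  rcases lt_trichotomy a b with h | h | h
  · exact (key a b h ha hb).elim
  · exact h
  · exact (key b a h hb ha).elim

open Classical in
lemma lt_card_j {N : ℕ} (k : Fin N) (X : Fin N → E2) :
    (Finset.univ.filter (fun j => X ∈ ltA j k)).card ≤ 8 := by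
  let f : Fin N → Bool × Bool × Bool := fun j =>
    (decide (0 ≤ (X j - X k) 0), decide (0 ≤ (X j - X k) 1), decide (|(X j - X k) 0| ≤ |(X j - X k) 1|))
  have : (Finset.univ.filter (fun j => X ∈ ltA j k)).card ≤ (Finset.univ : Finset (Bool × Bool × Bool)).card := by
    apply Finset.card_le_card_of_injOn f (fun _ _ => Finset.mem_coe.2 (Finset.mem_univ _))
    intro a ha b hb hab
    simp only [Finset.coe_filter, Finset.mem_univ, true_and, Set.mem_ofPred_eq] at ha hb
    by_contra hne
    simp only [f, Prod.mk.injEq, decide_eq_decide] at hab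
    obtain ⟨s0, s1, s2⟩ := hab
    have na := lt_A_ne ha
    have nb := lt_A_ne hb
    have h1 := (ha.2 b (Ne.symm hne) nb).1
    have h2 := (hb.2 a hne na).1
    have e : X a - X b = (X a - X k) - (X b - X k) := by abel
    rw [norm_sub_rev (X b) (X a)] at h2
    rw [e] at h1 h2
    have p1 : 0 < ‖X a - X k‖ := norm_pos_iff.2 (sub_ne_zero.2 ha.1)
    have p2 : 0 < ‖X b - X k‖ := norm_pos_iff.2 (sub_ne_zero.2 hb.1)
    generalize X a - X k = v at *
    generalize X b - X k = w at *
    have q1 : ‖v‖ ^ 2 ≤ ‖v - w‖ ^ 2 := by gcongr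
    have q2 : ‖w‖ ^ 2 ≤ ‖v - w‖ ^ 2 := by gcongr
    have q3 : 0 < ‖v‖ ^ 2 := by positivity
    have q4 : 0 < ‖w‖ ^ 2 := by positivity
    simp only [lt_normsq] at q1 q2 q3 q4
    refine lt_octant (v 0) (v 1) (w 0) (w 1) ?_ ?_ ?_ q1 q2 q3 q4
    · by_cases h : 0 ≤ v 0
      · exact mul_nonneg h (s0.1 h)
      · have h' : ¬ 0 ≤ w 0 := fun h2 => h (s0.2 h2)
        exact mul_nonneg_of_nonpos_of_nonpos (not_le.1 h).le (not_le.1 h').le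
    · by_cases h : 0 ≤ v 1
      · exact mul_nonneg h (s1.1 h)
      · have h' : ¬ 0 ≤ w 1 := fun h2 => h (s1.2 h2)
        exact mul_nonneg_of_nonpos_of_nonpos (not_le.1 h).le (not_le.1 h').le
    · by_cases h : |v 0| ≤ |v 1|
      · exact Or.inl ⟨h, s2.1 h⟩
      · have h' : ¬ |w 0| ≤ |w 1| := fun h2 => h (s2.2 h2)
        exact Or.inr ⟨(not_le.1 h).le, (not_le.1 h').le⟩
  simpa using this

lemma lt_mult {N : ℕ} (α : ℝ) (Ψ : (Fin N → E2) → ℂ) (X : Fin N → E2) :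
    ∑ j, ∑ k, ltG α Ψ j k X ≤ 9 * ∑ j, ENNReal.ofReal (ltT α Ψ j X) := by
  classical
  have h1 : ∀ j k, ltG α Ψ j k X = (if X ∈ ltA j k then ENNReal.ofReal (ltT α Ψ j X) else 0)
      + (if X ∈ ltA j k then ENNReal.ofReal (ltT α Ψ k X) else 0) := by
    intro j k
    unfold ltG
    rw [Set.indicator_apply]
    split_ifs
    · exact ENNReal.ofReal_add (lt_T_nonneg _ _ _ _) (lt_T_nonneg _ _ _ _)
    · simp
  simp_rw [h1, Finset.sum_add_distrib]
  have e : (9 : ENNReal) = 1 + 8 := by norm_num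
  rw [e, add_mul]
  refine add_le_add ?_ ?_
  · rw [one_mul]
    apply Finset.sum_le_sum
    intro j _
    rw [← Finset.sum_filter, Finset.sum_const, nsmul_eq_mul]
    calc _ ≤ (1 : ENNReal) * ENNReal.ofReal (ltT α Ψ j X) := by
          gcongr
          exact_mod_cast lt_card_k j X
      _ = _ := one_mul _
  · rw [Finset.sum_comm, Finset.mul_sum]
    apply Finset.sum_le_sum
    intro k _
    rw [← Finset.sum_filter, Finset.sum_const, nsmul_eq_mul]
    gcongr
    exact_mod_cast lt_card_j k X

lemma lt_W {N : ℕ} (α : ℝ) (hα : α ∈ Set.Icc (0 : ℝ) 2) (hα1 : α ≠ 1) (Ψ : (Fin N → E2) → ℂ)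
    (hΨ : ContDiff ℝ 1 Ψ) (hanti : Antisym N Ψ) :
    ∑ j, ∫⁻ X, ∑ k, ltF Ψ j k X ≤ ENNReal.ofReal (30 / |1 - α|) * (9 * ∑ j, ∫⁻ X, ENNReal.ofReal (ltT α Ψ j X)) := by
  have hT : ∀ j, Measurable (fun X => ENNReal.ofReal (ltT α Ψ j X)) := fun j =>
    ENNReal.measurable_ofReal.comp (lt_meas_T α Ψ hΨ j)
  calc _ = ∑ j, ∑ k, ∫⁻ X, ltF Ψ j k X := by
        apply Finset.sum_congr rfl; intro j _
        exact lintegral_finsetSum _ (fun k _ => lt_meas_F Ψ hΨ j k)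
    _ ≤ ∑ j, ∑ k, ENNReal.ofReal (30 / |1 - α|) * ∫⁻ X, ltG α Ψ j k X := by
        apply Finset.sum_le_sum; intro j _
        apply Finset.sum_le_sum; intro k _
        by_cases hjk : j = k
        · subst hjk
          have : ∀ X, ltF Ψ j j X = 0 := by
            intro X
            unfold ltF
            rw [Set.indicator_of_notMem]
            intro h; exact h.1 rfl
          simp [this]
        · exact lt_pair α hα hα1 Ψ hΨ hanti j k hjk
    _ = ENNReal.ofReal (30 / |1 - α|) * ∫⁻ X, ∑ j, ∑ k, ltG α Ψ j k X := by
        rw [lintegral_finsetSum _ (fun j _ => Finset.measurable_sum _ (fun k _ => lt_meas_G α Ψ hΨ j k)), Finset.mul_sum]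
        apply Finset.sum_congr rfl; intro j _
        rw [lintegral_finsetSum _ (fun k _ => lt_meas_G α Ψ hΨ j k), Finset.mul_sum]
    _ ≤ ENNReal.ofReal (30 / |1 - α|) * ∫⁻ X, 9 * ∑ j, ENNReal.ofReal (ltT α Ψ j X) := by
        refine mul_le_mul_right (lintegral_mono fun X => lt_mult α Ψ X) _
    _ = _ := by
        rw [lintegral_const_mul _ (Finset.measurable_sum _ (fun j _ => hT j)), lintegral_finsetSum _ (fun j _ => hT j)]

/-- Half-open square. -/
def ltQ (a b L : ℝ) : Set E2 := {x | x 0 ∈ Set.Ico a (a + L) ∧ x 1 ∈ Set.Ico b (b + L)}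

lemma lt_meas_Q (a b L : ℝ) : MeasurableSet (ltQ a b L) := by
  unfold ltQ
  have h0 : Measurable (fun x : E2 => x 0) := by fun_prop
  have h1 : Measurable (fun x : E2 => x 1) := by fun_prop
  exact (h0 measurableSet_Ico).inter (h1 measurableSet_Ico)

lemma lt_Q_diam (a b L : ℝ) (x y : E2) (hx : x ∈ ltQ a b L) (hy : y ∈ ltQ a b L) : ‖x - y‖ ^ 2 ≤ 2 * L ^ 2 := by
  rw [lt_normsq]
  obtain ⟨⟨x1, x2⟩, x3, x4⟩ := hx
  obtain ⟨⟨y1, y2⟩, y3, y4⟩ := hy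
  simp only [PiLp.sub_apply]
  have h0 : (x 0 - y 0) ^ 2 ≤ L ^ 2 := by
    apply sq_le_sq' <;> linarith
  have h1 : (x 1 - y 1) ^ 2 ≤ L ^ 2 := by
    apply sq_le_sq' <;> linarith
  linarith

/-- Localized one-body quantity. -/
def ltM {N : ℕ} (f : Fin N → (Fin N → E2) → ENNReal) (Q : Set E2) : ENNReal :=
  ∑ j, ∫⁻ X : Fin N → E2, Q.indicator 1 (X j) * f j X

/-- A nearest neighbour exists off the diagonal. -/
lemma lt_nn_exists {N : ℕ} (X : Fin N → E2) (hX : ∀ j k, j ≠ k → X j ≠ X k) (j i : Fin N) (hij : i ≠ j) :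
    ∃ k, X ∈ ltA j k := by
  classical
  let S := Finset.univ.erase j
  have hS : S.Nonempty := ⟨i, by simp [S, hij]⟩
  obtain ⟨m, hmS, hm⟩ := Finset.exists_min_image S (fun l => ‖X j - X l‖) hS
  let S' := S.filter (fun l => ‖X j - X l‖ = ‖X j - X m‖)
  have hS' : S'.Nonempty := ⟨m, by simp [S', hmS]⟩
  obtain ⟨k, hkS, hk⟩ := Finset.exists_min_image S' id hS'
  simp only [S', Finset.mem_filter] at hkS
  have hkj : k ≠ j := (Finset.mem_erase.1 hkS.1).1
  refine ⟨k, hX j k hkj.symm, fun l hlj hlk => ?_⟩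
  have hlS : l ∈ S := by simp [S, hlj]
  have h1 : ‖X j - X k‖ ≤ ‖X j - X l‖ := by rw [hkS.2]; exact hm l hlS
  refine ⟨h1, fun hlt => lt_of_le_of_ne h1 ?_⟩
  intro heq
  have := hk l (by simp only [S', Finset.mem_filter]; exact ⟨hlS, by rw [← heq, hkS.2]⟩)
  simp only [id] at this
  omega

lemma lt_D_bound {N : ℕ} (X : Fin N → E2) (j k i : Fin N) (hk : X ∈ ltA j k) (hij : i ≠ j) (hik : i ≠ k) (L : ℝ)
    (hL : 0 < L) (hQ : ‖X j - X i‖ ^ 2 ≤ 2 * L ^ 2) : 2 / (9 * L ^ 2) ≤ 1 / ltD j k X ^ 2 := by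
  have hne : Nonempty {l : Fin N // l ≠ j ∧ l ≠ k} := ⟨⟨i, hij, hik⟩⟩
  have hr : 0 < ‖X j - X k‖ := norm_pos_iff.2 (sub_ne_zero.2 hk.1)
  have hRj : ‖X j - (1 / 2 : ℝ) • (X j + X k)‖ = ‖X j - X k‖ / 2 := by
    have : X j - (1 / 2 : ℝ) • (X j + X k) = (1 / 2 : ℝ) • (X j - X k) := by
      ext c; simp; ring
    rw [this, norm_smul]; norm_num; ring
  have hDlow : ‖X j - X k‖ / 2 ≤ ltD j k X := by
    apply le_ciInf
    intro l
    have h1 := (hk.2 l l.2.1 l.2.2).1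
    have h2 : ‖X j - X l‖ ≤ ‖X j - (1 / 2 : ℝ) • (X j + X k)‖ + ‖X l - (1 / 2 : ℝ) • (X j + X k)‖ := by
      rw [norm_sub_rev (X l)]
      exact norm_sub_le_norm_sub_add_norm_sub _ _ _
    linarith
  have hDup : ltD j k X ≤ 3 / 2 * ‖X j - X i‖ := by
    have h0 : ltD j k X ≤ ‖X i - (1 / 2 : ℝ) • (X j + X k)‖ :=
      ciInf_le (f := fun l : {l : Fin N // l ≠ j ∧ l ≠ k} => ‖X l - (1 / 2 : ℝ) • (X j + X k)‖) ⟨0, by rintro _ ⟨l, rfl⟩; exact norm_nonneg _⟩ ⟨i, hij, hik⟩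
    have h2 : ‖X i - (1 / 2 : ℝ) • (X j + X k)‖ ≤ ‖X i - X j‖ + ‖X j - (1 / 2 : ℝ) • (X j + X k)‖ :=
      norm_sub_le_norm_sub_add_norm_sub _ _ _
    rw [norm_sub_rev (X i) (X j)] at h2
    have h3 := (hk.2 i hij hik).1
    linarith
  have hDpos : 0 < ltD j k X := by linarith
  rw [div_le_div_iff₀ (by positivity) (by positivity)]
  have : ltD j k X ^ 2 ≤ (3 / 2 * ‖X j - X i‖) ^ 2 := by gcongr
  nlinarith

lemma lt_excl_pt {N : ℕ} (Ψ : (Fin N → E2) → ℂ)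
    (hdiag : ∀ X : Fin N → E2, (∃ j k, j ≠ k ∧ X j = X k) → Ψ X = 0) (a b L : ℝ) (hL : 0 < L) (X : Fin N → E2) :
    ENNReal.ofReal (2 / (9 * L ^ 2)) * ∑ j, (ltQ a b L).indicator 1 (X j) * ENNReal.ofReal (‖Ψ X‖ ^ 2)
      ≤ (∑ j, (ltQ a b L).indicator 1 (X j) * ∑ k, ltF Ψ j k X)
        + ENNReal.ofReal (2 / (9 * L ^ 2)) * (2 * ENNReal.ofReal (‖Ψ X‖ ^ 2)) := by
  classical
  by_cases hX : ∃ j k, j ≠ k ∧ X j = X k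
  · simp [hdiag X hX]
  push Not at hX
  set S := Finset.univ.filter (fun j => X j ∈ ltQ a b L) with hS
  have hind : ∀ j, (ltQ a b L).indicator (1 : E2 → ENNReal) (X j) = if X j ∈ ltQ a b L then 1 else 0 := by
    intro j; rw [Set.indicator_apply]; rfl
  simp_rw [hind, ite_mul, one_mul, zero_mul]
  rw [← Finset.sum_filter, ← Finset.sum_filter, ← hS]
  by_cases hc : S.card ≤ 2
  · refine le_trans ?_ le_add_self
    refine mul_le_mul_right ?_ _
    rw [Finset.sum_const, nsmul_eq_mul]
    gcongr
    exact_mod_cast hc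
  · refine le_trans ?_ le_self_add
    rw [Finset.mul_sum]
    apply Finset.sum_le_sum
    intro j hj
    push Not at hc
    have hjQ : X j ∈ ltQ a b L := by simpa [hS] using hj
    obtain ⟨i0, hi0, hi0j⟩ := Finset.exists_mem_ne (by omega) j (s := S)
    obtain ⟨k, hk⟩ := lt_nn_exists X hX j i0 hi0j
    have : ∃ i ∈ S, i ≠ j ∧ i ≠ k := by
      have hcard : 0 < ((S.erase j).erase k).card := by
        have h1 := Finset.pred_card_le_card_erase (s := S) (a := j)
        have h2 := Finset.pred_card_le_card_erase (s := S.erase j) (a := k)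
        omega
      obtain ⟨i, hi⟩ := Finset.card_pos.1 hcard
      simp only [Finset.mem_erase] at hi
      exact ⟨i, hi.2.2, hi.2.1, hi.1⟩
    obtain ⟨i, hiS, hij, hik⟩ := this
    have hiQ : X i ∈ ltQ a b L := by simpa [hS] using hiS
    have hb := lt_D_bound X j k i hk hij hik L hL (lt_Q_diam a b L _ _ hjQ hiQ)
    refine le_trans ?_ (Finset.single_le_sum (f := fun k => ltF Ψ j k X) (fun _ _ => zero_le) (Finset.mem_univ k))
    simp only [ltF]
    rw [Set.indicator_of_mem hk]
    gcongr

lemma lt_meas_ind {N : ℕ} (Q : Set E2) (hQ : MeasurableSet Q) (j : Fin N) :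
    Measurable (fun X : Fin N → E2 => Q.indicator (1 : E2 → ENNReal) (X j)) :=
  (measurable_one.indicator hQ).comp (measurable_pi_apply j)

lemma lt_excl {N : ℕ} (Ψ : (Fin N → E2) → ℂ) (hΨ : ContDiff ℝ 1 Ψ)
    (hdiag : ∀ X : Fin N → E2, (∃ j k, j ≠ k ∧ X j = X k) → Ψ X = 0)
    (hnorm : ∫⁻ X, ENNReal.ofReal (‖Ψ X‖ ^ 2) = 1) (a b L : ℝ) (hL : 0 < L) :
    ENNReal.ofReal (2 / (9 * L ^ 2)) * ltM (fun _ X => ENNReal.ofReal (‖Ψ X‖ ^ 2)) (ltQ a b L)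
      ≤ ltM (fun j X => ∑ k, ltF Ψ j k X) (ltQ a b L) + ENNReal.ofReal (2 / (9 * L ^ 2)) * 2 := by
  have hm := hΨ.continuous.measurable
  have hQ := lt_meas_Q a b L
  have hi := fun j => lt_meas_ind (N := N) (ltQ a b L) hQ j
  have hF : ∀ j, Measurable (fun X => ∑ k, ltF Ψ j k X) := fun j => Finset.measurable_sum _ (fun k _ => lt_meas_F Ψ hΨ j k)
  have h := lintegral_mono (μ := volume) (fun X => lt_excl_pt Ψ hdiag a b L hL X)
  have hm1 : ∀ j, Measurable (fun X => (ltQ a b L).indicator (1 : E2 → ENNReal) (X j) * ENNReal.ofReal (‖Ψ X‖ ^ 2)) :=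
    fun j => (hi j).mul (by fun_prop)
  have hm2 : ∀ j, Measurable (fun X => (ltQ a b L).indicator (1 : E2 → ENNReal) (X j) * ∑ k, ltF Ψ j k X) :=
    fun j => (hi j).mul (hF j)
  rw [lintegral_const_mul' _ _ ENNReal.ofReal_ne_top, lintegral_finsetSum _ (fun j _ => hm1 j),
    lintegral_add_left (Finset.measurable_sum _ (fun j _ => hm2 j)),
    lintegral_finsetSum _ (fun j _ => hm2 j), lintegral_const_mul' _ _ ENNReal.ofReal_ne_top,
    lintegral_const_mul _ (by fun_prop), hnorm, mul_one] at h
  exact h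

/-- Configuration with particle `j` at `x` and the others at `Y`. -/
def ltZ {N : ℕ} (j : Fin N) (x : E2) (Y : {k : Fin N // k ≠ j} → E2) : Fin N → E2 :=
  fun k => if h : k = j then x else Y ⟨k, h⟩

lemma ltZ_self {N : ℕ} (j : Fin N) (x : E2) (Y : {k : Fin N // k ≠ j} → E2) : ltZ j x Y j = x := by
  simp [ltZ]

lemma ltZ_meas {N : ℕ} (j : Fin N) : Measurable (fun z : E2 × ({k : Fin N // k ≠ j} → E2) => ltZ j z.1 z.2) := by
  rw [measurable_pi_iff]
  intro k
  by_cases h : k = j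
  · simp only [ltZ, h, dite_true]; fun_prop
  · simp only [ltZ, h, dite_false]; fun_prop

lemma lt_split {N : ℕ} (j : Fin N) (F : (Fin N → E2) → ENNReal) (hF : Measurable F) :
    ∫⁻ X, F X = ∫⁻ x, ∫⁻ Y, F (ltZ j x Y) := by
  have h1 := (volume_preserving_piEquivPiSubtypeProd (fun _ : Fin N => E2) (fun k => k = j)).symm
  rw [← h1.lintegral_comp_emb (MeasurableEquiv.measurableEmbedding _)]
  have hm : Measurable fun z => F ((MeasurableEquiv.piEquivPiSubtypeProd (fun _ : Fin N => E2) (fun k => k = j)).symm z) :=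
    hF.comp (MeasurableEquiv.measurable _)
  rw [Measure.volume_eq_prod, lintegral_prod _ hm.aemeasurable]
  have h2 := (volume_preserving_piUnique (fun _ : {k : Fin N // k = j} => E2)).symm
  have h3 := h2.lintegral_comp_emb (MeasurableEquiv.measurableEmbedding _) (fun x => ∫⁻ Y : {k : Fin N // ¬ k = j} → E2,
    F ((MeasurableEquiv.piEquivPiSubtypeProd (fun _ : Fin N => E2) (fun k => k = j)).symm (x, Y)))
  refine Eq.trans ?_ (h3.symm.trans ?_)
  · convert rfl
    rfl
  refine lintegral_congr fun x => lintegral_congr fun Y => ?_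
  congr 1

lemma lt_plane (F : E2 → ENNReal) (hF : Measurable F) : ∫⁻ x, F x = ∫⁻ p : ℝ, ∫⁻ q : ℝ, F !₂[p, q] := by
  have h1 := (EuclideanSpace.volume_preserving_symm_measurableEquiv_toLp (Fin 2)).symm
  rw [← h1.lintegral_comp_emb (MeasurableEquiv.measurableEmbedding _)]
  have h2 := (volume_preserving_finTwoArrow ℝ).symm
  rw [← h2.lintegral_comp_emb (MeasurableEquiv.measurableEmbedding _)]
  rw [Measure.volume_eq_prod, lintegral_prod]
  · rfl
  · exact (hF.comp ((MeasurableEquiv.measurable _).comp (MeasurableEquiv.measurable _))).aemeasurable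

/-- One-body marginal. -/
def ltR {N : ℕ} (f : Fin N → (Fin N → E2) → ENNReal) (x : E2) : ENNReal :=
  ∑ j, ∫⁻ Y, f j (ltZ j x Y)

lemma lt_meas_R0 {N : ℕ} (j : Fin N) (f : (Fin N → E2) → ENNReal) (hf : Measurable f) :
    Measurable (fun x => ∫⁻ Y, f (ltZ j x Y)) := by
  have : Measurable (fun z : E2 × ({k : Fin N // k ≠ j} → E2) => f (ltZ j z.1 z.2)) := hf.comp (ltZ_meas j)
  exact this.lintegral_prod_right'

lemma lt_meas_R {N : ℕ} (f : Fin N → (Fin N → E2) → ENNReal) (hf : ∀ j, Measurable (f j)) : Measurable (ltR f) := by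
  unfold ltR
  exact Finset.measurable_sum _ (fun j _ => lt_meas_R0 j _ (hf j))

lemma lt_M_eq {N : ℕ} (f : Fin N → (Fin N → E2) → ENNReal) (hf : ∀ j, Measurable (f j)) (Q : Set E2)
    (hQ : MeasurableSet Q) : ltM f Q = ∫⁻ x in Q, ltR f x := by
  unfold ltM ltR
  rw [lintegral_finsetSum _ (fun j _ => lt_meas_R0 j _ (hf j))]
  refine Finset.sum_congr rfl fun j _ => ?_
  have hm : Measurable (fun X => Q.indicator (1 : E2 → ENNReal) (X j) * f j X) := (lt_meas_ind Q hQ j).mul (hf j)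
  rw [lt_split j _ hm, ← lintegral_indicator hQ]
  refine lintegral_congr fun x => ?_
  simp only [ltZ_self]
  by_cases hx : x ∈ Q
  · simp [Set.indicator_of_mem hx]
  · simp [Set.indicator_of_notMem hx]

/-- One-dimensional Sobolev inequality. -/
lemma lt_sob1 (f : ℝ → ℝ) (hf : ContDiff ℝ 1 f) (a L : ℝ) (hL : 0 < L) (p : ℝ)
    (hp : p ∈ Set.Ico a (a + L)) :
    ENNReal.ofReal (f p) ≤ ENNReal.ofReal (1 / L) * (∫⁻ s in Set.Ico a (a + L), ENNReal.ofReal (f s))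
      + ∫⁻ s in Set.Ico a (a + L), ‖deriv f s‖ₑ := by
  set I := Set.Ico a (a + L)
  set D := ∫⁻ s in I, ‖deriv f s‖ₑ
  have key : ∀ s ∈ I, ENNReal.ofReal (f p) ≤ ENNReal.ofReal (f s) + D := by
    intro s hs
    have h1 : ‖f p - f s‖ₑ ≤ D := by
      rcases le_total s p with h | h
      · refine (enorm_sub_le_lintegral_deriv_of_contDiffOn_Icc hf.contDiffOn h).trans ?_
        exact lintegral_mono_set (fun t ht => ⟨hs.1.trans ht.1, ht.2.trans_lt hp.2⟩)
      · rw [← enorm_neg, neg_sub]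
        refine (enorm_sub_le_lintegral_deriv_of_contDiffOn_Icc hf.contDiffOn h).trans ?_
        exact lintegral_mono_set (fun t ht => ⟨hp.1.trans ht.1, ht.2.trans_lt hs.2⟩)
    calc ENNReal.ofReal (f p) = ENNReal.ofReal (f s + (f p - f s)) := by ring_nf
      _ ≤ ENNReal.ofReal (f s) + ENNReal.ofReal (f p - f s) := ENNReal.ofReal_add_le
      _ ≤ ENNReal.ofReal (f s) + ‖f p - f s‖ₑ := by
        gcongr; rw [← ofReal_norm]; exact ENNReal.ofReal_le_ofReal (le_abs_self _)
      _ ≤ _ := by gcongr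
  have hvol : volume I = ENNReal.ofReal L := by simp [I]
  have hav : ∫⁻ _s in I, ENNReal.ofReal (f p) ≤ ∫⁻ s in I, (ENNReal.ofReal (f s) + D) :=
    setLIntegral_mono' measurableSet_Ico key
  rw [lintegral_add_right _ measurable_const, setLIntegral_const, setLIntegral_const, hvol] at hav
  have h1 : ENNReal.ofReal (1 / L) * ENNReal.ofReal L = 1 := by
    rw [← ENNReal.ofReal_mul (by positivity)]; simp [hL.ne']
  calc ENNReal.ofReal (f p) = ENNReal.ofReal (1 / L) * (ENNReal.ofReal (f p) * ENNReal.ofReal L) := by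
        rw [mul_comm (ENNReal.ofReal (f p)), ← mul_assoc, h1, one_mul]
    _ ≤ _ := mul_le_mul_right hav _
    _ = _ := by rw [mul_add, mul_comm D, ← mul_assoc _ _ D, h1, one_mul]

/-- Density of the gradient of `|Ψ|²`. -/
def ltg {N : ℕ} (α : ℝ) (Ψ : (Fin N → E2) → ℂ) (j : Fin N) (X : Fin N → E2) : ENNReal :=
  ENNReal.ofReal (2 * ‖Ψ X‖ * √(ltT α Ψ j X))

/-- Density. -/
def ltu {N : ℕ} (Ψ : (Fin N → E2) → ℂ) (_j : Fin N) (X : Fin N → E2) : ENNReal :=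
  ENNReal.ofReal (‖Ψ X‖ ^ 2)

lemma lt_meas_g {N : ℕ} (α : ℝ) (Ψ : (Fin N → E2) → ℂ) (hΨ : ContDiff ℝ 1 Ψ) (j : Fin N) : Measurable (ltg α Ψ j) := by
  have h1 := lt_meas_T α Ψ hΨ j
  have h2 := hΨ.continuous.measurable
  unfold ltg
  fun_prop

lemma lt_meas_u {N : ℕ} (Ψ : (Fin N → E2) → ℂ) (hΨ : ContDiff ℝ 1 Ψ) (j : Fin N) : Measurable (ltu Ψ j) := by
  have h2 := hΨ.continuous.measurable
  unfold ltu
  fun_prop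

lemma lt_line {N : ℕ} (α : ℝ) (Ψ : (Fin N → E2) → ℂ) (hΨ : ContDiff ℝ 1 Ψ) (j : Fin N) (c : Fin 2)
    (γ : ℝ → Fin N → E2) (hγ : ContDiff ℝ 1 γ) (hγ' : ∀ s, HasDerivAt γ (dirv N j c) s) (a L : ℝ) (hL : 0 < L) (p : ℝ)
    (hp : p ∈ Set.Ico a (a + L)) :
    ltu Ψ j (γ p) ≤ ENNReal.ofReal (1 / L) * (∫⁻ s in Set.Ico a (a + L), ltu Ψ j (γ s))
      + ∫⁻ s in Set.Ico a (a + L), ltg α Ψ j (γ s) := by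
  have hf : ContDiff ℝ 1 (fun s => ‖Ψ (γ s)‖ ^ 2) := (hΨ.comp hγ).norm_sq ℝ
  refine (lt_sob1 _ hf a L hL p hp).trans ?_
  unfold ltu
  refine add_le_add le_rfl (lintegral_mono fun s => ?_)
  have hd : HasDerivAt (fun s => Ψ (γ s)) (fderiv ℝ Ψ (γ s) (dirv N j c)) s :=
    ((hΨ.differentiable (by norm_num) (γ s)).hasFDerivAt).comp_hasDerivAt s (hγ' s)
  have hd2 := hd.norm_sq
  rw [hd2.deriv, lt_fderiv_eq α, ← ofReal_norm, Real.norm_eq_abs]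
  unfold ltg
  apply ENNReal.ofReal_le_ofReal
  refine (lt_dsq _ _ _).trans ?_
  gcongr
  apply Real.le_sqrt_of_sq_le
  exact Finset.single_le_sum (f := fun c => ‖covDIdeal α Ψ j (γ s) c‖ ^ 2) (fun _ _ => by positivity) (Finset.mem_univ c)

lemma lt_slice0 {N : ℕ} (α : ℝ) (Ψ : (Fin N → E2) → ℂ) (hΨ : ContDiff ℝ 1 Ψ) (c : Fin 2) (w : E2)
    (a L : ℝ) (hL : 0 < L) (p : ℝ) (hp : p ∈ Set.Ico a (a + L)) :
    ltR (ltu Ψ) (w + p • basisVec c) ≤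
      ENNReal.ofReal (1 / L) * (∫⁻ s in Set.Ico a (a + L), ltR (ltu Ψ) (w + s • basisVec c))
      + ∫⁻ s in Set.Ico a (a + L), ltR (ltg α Ψ) (w + s • basisVec c) := by
  have hl : Measurable (fun s : ℝ => w + s • basisVec c) := by fun_prop
  have hsw : ∀ (f : Fin N → (Fin N → E2) → ENNReal) (_ : ∀ j, Measurable (f j)),
      ∫⁻ s in Set.Ico a (a + L), ltR f (w + s • basisVec c)
        = ∑ j, ∫⁻ Y, ∫⁻ s in Set.Ico a (a + L), f j (ltZ j (w + s • basisVec c) Y) := by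
    intro f hf
    unfold ltR
    have hcomp : ∀ j, Measurable (fun s : ℝ => ∫⁻ Y, f j (ltZ j (w + s • basisVec c) Y)) :=
      fun j => (lt_meas_R0 j _ (hf j)).comp hl
    rw [lintegral_finsetSum _ (fun j _ => hcomp j)]
    refine Finset.sum_congr rfl fun j _ => ?_
    apply lintegral_lintegral_swap
    have : Measurable (fun z : ℝ × ({k : Fin N // k ≠ j} → E2) => f j (ltZ j (w + z.1 • basisVec c) z.2)) :=
      (hf j).comp ((ltZ_meas j).comp ((hl.comp measurable_fst).prodMk measurable_snd))
    exact this.aemeasurable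
  have hms : ∀ (f : Fin N → (Fin N → E2) → ENNReal) (_ : ∀ j, Measurable (f j)) (j : Fin N),
      Measurable (fun Y => ∫⁻ s in Set.Ico a (a + L), f j (ltZ j (w + s • basisVec c) Y)) := by
    intro f hf j
    have : Measurable (fun z : ({k : Fin N // k ≠ j} → E2) × ℝ => f j (ltZ j (w + z.2 • basisVec c) z.1)) :=
      (hf j).comp ((ltZ_meas j).comp ((hl.comp measurable_snd).prodMk measurable_fst))
    exact this.lintegral_prod_right'
  rw [hsw _ (lt_meas_u Ψ hΨ), hsw _ (lt_meas_g α Ψ hΨ), Finset.mul_sum, ← Finset.sum_add_distrib]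
  unfold ltR
  refine Finset.sum_le_sum fun j _ => ?_
  rw [← lintegral_const_mul _ (hms _ (lt_meas_u Ψ hΨ) j), ← lintegral_add_right _ (hms _ (lt_meas_g α Ψ hΨ) j)]
  refine lintegral_mono fun Y => ?_
  refine lt_line α Ψ hΨ j c (fun s => ltZ j (w + s • basisVec c) Y) ?_ ?_ a L hL p hp
  · rw [contDiff_pi]
    intro k
    by_cases h : k = j
    · simp only [ltZ, h, dite_true]; fun_prop
    · simp only [ltZ, h, dite_false]; fun_prop
  · intro s
    rw [hasDerivAt_pi]
    intro k
    by_cases h : k = j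
    · subst h
      simp only [ltZ, dite_true, dirv, Function.update_self]
      have := ((hasDerivAt_id s).smul_const (basisVec c)).const_add w
      simpa using this
    · simp only [ltZ, h, dite_false, dirv, Function.update_of_ne h, Pi.zero_apply]
      exact hasDerivAt_const _ _

lemma lt_vec (p q : ℝ) : !₂[p, q] = q • basisVec 1 + p • basisVec 0 ∧ !₂[p, q] = p • basisVec 0 + q • basisVec 1 := by
  constructor <;> · ext i; fin_cases i <;> simp [basisVec]

lemma lt_planeQ (F : E2 → ENNReal) (hF : Measurable F) (a b L : ℝ) :
    ∫⁻ x in ltQ a b L, F x = ∫⁻ p in Set.Ico a (a + L), ∫⁻ q in Set.Ico b (b + L), F !₂[p, q] := by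
  rw [← lintegral_indicator (lt_meas_Q a b L), lt_plane _ (hF.indicator (lt_meas_Q a b L)),
    ← lintegral_indicator measurableSet_Ico]
  refine lintegral_congr fun p => ?_
  by_cases hp : p ∈ Set.Ico a (a + L)
  · rw [Set.indicator_of_mem hp, ← lintegral_indicator measurableSet_Ico]
    refine lintegral_congr fun q => ?_
    by_cases hq : q ∈ Set.Ico b (b + L)
    · rw [Set.indicator_of_mem hq, Set.indicator_of_mem]
      exact ⟨by simpa using hp, by simpa using hq⟩
    · rw [Set.indicator_of_notMem hq, Set.indicator_of_notMem]
      rintro ⟨_, h⟩; exact hq (by simpa using h)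
  · rw [Set.indicator_of_notMem hp]
    rw [← lintegral_zero (μ := (volume : Measure ℝ))]
    refine lintegral_congr fun q => ?_
    rw [Set.indicator_of_notMem]
    rintro ⟨h, _⟩; exact hp (by simpa using h)

lemma lt_lady {N : ℕ} (α : ℝ) (Ψ : (Fin N → E2) → ℂ) (hΨ : ContDiff ℝ 1 Ψ) (a b L : ℝ) (hL : 0 < L) :
    ∫⁻ x in ltQ a b L, ltR (ltu Ψ) x ^ 2 ≤
      (ENNReal.ofReal (1 / L) * ltM (ltu Ψ) (ltQ a b L) + ltM (ltg α Ψ) (ltQ a b L)) ^ 2 := by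
  set u := ltR (ltu Ψ)
  set g := ltR (ltg α Ψ)
  have hu : Measurable u := lt_meas_R _ (lt_meas_u Ψ hΨ)
  have hg : Measurable g := lt_meas_R _ (lt_meas_g α Ψ hΨ)
  have hv : Measurable (fun z : ℝ × ℝ => !₂[z.1, z.2]) := by
    simp_rw [(lt_vec _ _).1]; fun_prop
  have hv' : Measurable (fun z : ℝ × ℝ => !₂[z.2, z.1]) := hv.comp measurable_swap
  set I := Set.Ico a (a + L)
  set K := Set.Ico b (b + L)
  let A : ℝ → ENNReal := fun q => ENNReal.ofReal (1 / L) * (∫⁻ s in I, u !₂[s, q]) + ∫⁻ s in I, g !₂[s, q]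
  let B : ℝ → ENNReal := fun p => ENNReal.ofReal (1 / L) * (∫⁻ s in K, u !₂[p, s]) + ∫⁻ s in K, g !₂[p, s]
  have m1 : ∀ f : E2 → ENNReal, Measurable f → Measurable (fun q => ∫⁻ s in I, f !₂[s, q]) := fun f hf => by
    have : Measurable (fun z : ℝ × ℝ => f !₂[z.2, z.1]) := hf.comp hv'
    exact this.lintegral_prod_right'
  have m2 : ∀ f : E2 → ENNReal, Measurable f → Measurable (fun p => ∫⁻ s in K, f !₂[p, s]) := fun f hf => by
    have : Measurable (fun z : ℝ × ℝ => f !₂[z.1, z.2]) := hf.comp hv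
    exact this.lintegral_prod_right'
  have hA : Measurable A := ((m1 u hu).const_mul _).add (m1 g hg)
  have hB : Measurable B := ((m2 u hu).const_mul _).add (m2 g hg)
  have uA : ∀ p ∈ I, ∀ q, u !₂[p, q] ≤ A q := by
    intro p hp q
    have := lt_slice0 α Ψ hΨ 0 (q • basisVec 1) a L hL p hp
    simp_rw [← (lt_vec _ _).1] at this
    exact this
  have uB : ∀ q ∈ K, ∀ p, u !₂[p, q] ≤ B p := by
    intro q hq p
    have := lt_slice0 α Ψ hΨ 1 (p • basisVec 0) b L hL q hq
    simp_rw [← (lt_vec _ _).2] at this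
    exact this
  have sw : ∀ f : E2 → ENNReal, Measurable f → ∫⁻ q in K, ∫⁻ s in I, f !₂[s, q] = ∫⁻ x in ltQ a b L, f x := by
    intro f hf
    rw [lt_planeQ f hf]
    apply lintegral_lintegral_swap
    exact (hf.comp hv').aemeasurable
  have iA : ∫⁻ q in K, A q = ENNReal.ofReal (1 / L) * ltM (ltu Ψ) (ltQ a b L) + ltM (ltg α Ψ) (ltQ a b L) := by
    rw [lt_M_eq _ (lt_meas_u Ψ hΨ) _ (lt_meas_Q a b L), lt_M_eq _ (lt_meas_g α Ψ hΨ) _ (lt_meas_Q a b L)]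
    simp only [A]
    rw [lintegral_add_right _ (m1 g hg), lintegral_const_mul _ (m1 u hu), sw u hu, sw g hg]
  have iB : ∫⁻ p in I, B p = ENNReal.ofReal (1 / L) * ltM (ltu Ψ) (ltQ a b L) + ltM (ltg α Ψ) (ltQ a b L) := by
    rw [lt_M_eq _ (lt_meas_u Ψ hΨ) _ (lt_meas_Q a b L), lt_M_eq _ (lt_meas_g α Ψ hΨ) _ (lt_meas_Q a b L)]
    simp only [B]
    rw [lintegral_add_right _ (m2 g hg), lintegral_const_mul _ (m2 u hu), lt_planeQ _ hu, lt_planeQ _ hg]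
  rw [lt_planeQ _ (hu.pow_const 2)]
  calc _ ≤ ∫⁻ p in I, ∫⁻ q in K, B p * A q := by
        refine setLIntegral_mono' measurableSet_Ico fun p hp => setLIntegral_mono' measurableSet_Ico fun q hq => ?_
        rw [sq]
        exact mul_le_mul' (uB q hq p) (uA p hp q)
    _ = _ := by
        simp_rw [lintegral_const_mul _ hA]
        rw [lintegral_mul_const _ hB, iA, iB, sq]

lemma lt_G_le {N : ℕ} (α : ℝ) (Ψ : (Fin N → E2) → ℂ) (hΨ : ContDiff ℝ 1 Ψ) (Q : Set E2) (hQ : MeasurableSet Q)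
    (ε : ℝ) (hε : 0 < ε) :
    ltM (ltg α Ψ) Q ≤ ENNReal.ofReal ε * ltM (ltu Ψ) Q
      + ENNReal.ofReal (1 / ε) * ltM (fun j X => ENNReal.ofReal (ltT α Ψ j X)) Q := by
  unfold ltM
  rw [Finset.mul_sum, Finset.mul_sum, ← Finset.sum_add_distrib]
  refine Finset.sum_le_sum fun j _ => ?_
  have hm1 : Measurable (fun X => Q.indicator (1 : E2 → ENNReal) (X j) * ltu Ψ j X) :=
    (lt_meas_ind Q hQ j).mul (lt_meas_u Ψ hΨ j)
  rw [← lintegral_const_mul' _ _ ENNReal.ofReal_ne_top, ← lintegral_const_mul' _ _ ENNReal.ofReal_ne_top,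
    ← lintegral_add_left (hm1.const_mul _)]
  refine lintegral_mono fun X => ?_
  have : ltg α Ψ j X ≤ ENNReal.ofReal ε * ltu Ψ j X + ENNReal.ofReal (1 / ε) * ENNReal.ofReal (ltT α Ψ j X) := by
    unfold ltg ltu
    rw [← ENNReal.ofReal_mul hε.le, ← ENNReal.ofReal_mul (by positivity), ← ENNReal.ofReal_add (by positivity)
      (mul_nonneg (by positivity) (lt_T_nonneg α Ψ j X))]
    apply ENNReal.ofReal_le_ofReal
    have h1 := Real.sq_sqrt (lt_T_nonneg α Ψ j X)
    have h2 : ε * ‖Ψ X‖ ^ 2 + 1 / ε * ltT α Ψ j X - 2 * ‖Ψ X‖ * √(ltT α Ψ j X) = (1 / ε) * (ε * ‖Ψ X‖ - √(ltT α Ψ j X)) ^ 2 := by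
      field_simp
      rw [← h1, Real.sqrt_sq (Real.sqrt_nonneg _)]
      ring
    have h3 : 0 ≤ (1 / ε) * (ε * ‖Ψ X‖ - √(ltT α Ψ j X)) ^ 2 := by positivity
    linarith
  calc _ ≤ Q.indicator (1 : E2 → ENNReal) (X j) * (ENNReal.ofReal ε * ltu Ψ j X + ENNReal.ofReal (1 / ε) * ENNReal.ofReal (ltT α Ψ j X)) :=
        mul_le_mul_right this _
    _ = _ := by ring

lemma lt_opt (G τ : ENNReal) (M : ℝ) (hM : 0 < M)
    (h : ∀ ε : ℝ, 0 < ε → G ≤ ENNReal.ofReal ε * ENNReal.ofReal M + ENNReal.ofReal (1 / ε) * τ) :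
    G ^ 2 ≤ ENNReal.ofReal (4 * M) * τ := by
  by_cases hτ : τ = ⊤
  · rw [hτ, ENNReal.mul_top (by simpa using hM)]; exact le_top
  lift τ to NNReal using hτ
  have hG : G ≠ ⊤ := by
    refine ne_top_of_le_ne_top ?_ (h 1 one_pos)
    exact ENNReal.add_ne_top.2 ⟨ENNReal.mul_ne_top ENNReal.ofReal_ne_top ENNReal.ofReal_ne_top,
      ENNReal.mul_ne_top ENNReal.ofReal_ne_top ENNReal.coe_ne_top⟩
  lift G to NNReal using hG
  have h' : ∀ ε : ℝ, 0 < ε → (G : ℝ) ≤ ε * M + 1 / ε * τ := by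
    intro ε hε
    have := h ε hε
    rw [← ENNReal.ofReal_coe_nnreal (p := τ), ← ENNReal.ofReal_coe_nnreal (p := G), ← ENNReal.ofReal_mul hε.le,
      ← ENNReal.ofReal_mul (by positivity), ← ENNReal.ofReal_add (by positivity) (by positivity)] at this
    exact (ENNReal.ofReal_le_ofReal_iff (by positivity)).1 this
  have key : (G : ℝ) ^ 2 ≤ 4 * M * τ := by
    have hG0 : (0 : ℝ) ≤ G := G.2
    have hτ0 : (0 : ℝ) ≤ τ := τ.2
    by_cases hz : (G : ℝ) = 0
    · rw [hz]
      have : 0 ≤ 4 * M * (τ : ℝ) := by positivity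
      simpa using this
    have hGp : 0 < (G : ℝ) := lt_of_le_of_ne hG0 (Ne.symm hz)
    have := h' (G / (2 * M)) (by positivity)
    have e1 : (G : ℝ) / (2 * M) * M = G / 2 := by field_simp
    have e2 : 1 / ((G : ℝ) / (2 * M)) * τ = 2 * M * τ / G := by field_simp
    rw [e1, e2] at this
    have h3 : (G : ℝ) / 2 ≤ 2 * M * τ / G := by linarith
    rw [div_le_div_iff₀ two_pos hGp] at h3
    nlinarith
  rw [← ENNReal.ofReal_coe_nnreal (p := τ), ← ENNReal.ofReal_coe_nnreal (p := G), ← ENNReal.ofReal_pow (NNReal.coe_nonneg G),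
    ← ENNReal.ofReal_mul (by positivity)]
  exact ENNReal.ofReal_le_ofReal key

lemma lt_lady2 {N : ℕ} (α : ℝ) (Ψ : (Fin N → E2) → ℂ) (hΨ : ContDiff ℝ 1 Ψ) (a b L : ℝ) (hL : 0 < L)
    (hm : ltM (ltu Ψ) (ltQ a b L) ≤ 3) :
    ∫⁻ x in ltQ a b L, ltR (ltu Ψ) x ^ 2 ≤
      24 * ltM (fun j X => ENNReal.ofReal (ltT α Ψ j X)) (ltQ a b L) + ENNReal.ofReal (18 / L ^ 2) := by
  have h3 : (3 : ENNReal) = ENNReal.ofReal 3 := by norm_num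
  refine (lt_lady α Ψ hΨ a b L hL).trans ?_
  set G := ltM (ltg α Ψ) (ltQ a b L)
  set τ := ltM (fun j X => ENNReal.ofReal (ltT α Ψ j X)) (ltQ a b L)
  set m := ltM (ltu Ψ) (ltQ a b L)
  have hG : G ^ 2 ≤ ENNReal.ofReal (4 * 3) * τ := by
    apply lt_opt G τ 3 (by norm_num)
    intro ε hε
    refine (lt_G_le α Ψ hΨ _ (lt_meas_Q a b L) ε hε).trans ?_
    rw [← h3]
    gcongr
  have hsq : ∀ x y : ENNReal, (x + y) ^ 2 ≤ 2 * x ^ 2 + 2 * y ^ 2 := by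
    intro x y
    have := ENNReal.rpow_add_le_mul_rpow_add_rpow x y (p := 2) (by norm_num)
    norm_num at this
    rw [← mul_add]; exact this
  refine (hsq _ _).trans ?_
  rw [add_comm]
  refine add_le_add ?_ ?_
  · calc 2 * G ^ 2 ≤ 2 * (ENNReal.ofReal (4 * 3) * τ) := by gcongr
      _ = _ := by
        rw [← mul_assoc]; norm_num
  · calc 2 * (ENNReal.ofReal (1 / L) * m) ^ 2 ≤ 2 * (ENNReal.ofReal (1 / L) * ENNReal.ofReal 3) ^ 2 := by rw [← h3]; gcongr
      _ = _ := by
        rw [← ENNReal.ofReal_mul (by positivity), ← ENNReal.ofReal_pow (by positivity),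
          show (2 : ENNReal) = ENNReal.ofReal 2 by norm_num, ← ENNReal.ofReal_mul (by positivity)]
        congr 1; field_simp; norm_num

lemma lt_Q_vol (a b L : ℝ) : volume (ltQ a b L) = ENNReal.ofReal L * ENNReal.ofReal L := by
  rw [← setLIntegral_one, lt_planeQ (fun _ => 1) measurable_const]
  simp

lemma lt_Q_split (a b L : ℝ) (hL : 0 < L) (f : E2 → ENNReal) :
    ∫⁻ x in ltQ a b L, f x = (∫⁻ x in ltQ a b (L / 2), f x) + (∫⁻ x in ltQ (a + L / 2) b (L / 2), f x)
      + (∫⁻ x in ltQ a (b + L / 2) (L / 2), f x) + (∫⁻ x in ltQ (a + L / 2) (b + L / 2) (L / 2), f x) := by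
  have e : ltQ a b L = ((ltQ a b (L / 2) ∪ ltQ (a + L / 2) b (L / 2)) ∪ ltQ a (b + L / 2) (L / 2))
      ∪ ltQ (a + L / 2) (b + L / 2) (L / 2) := by
    ext x
    simp only [ltQ, Set.mem_union, Set.mem_ofPred_eq, Set.mem_Ico]
    constructor
    · rintro ⟨⟨h1, h2⟩, h3, h4⟩
      rcases lt_or_ge (x 0) (a + L / 2) with h | h <;> rcases lt_or_ge (x 1) (b + L / 2) with h' | h'
      · left; left; left; exact ⟨⟨h1, h⟩, h3, h'⟩
      · left; right; exact ⟨⟨h1, h⟩, h', by linarith⟩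
      · left; left; right; exact ⟨⟨h, by linarith⟩, h3, h'⟩
      · right; exact ⟨⟨h, by linarith⟩, h', by linarith⟩
    · rintro (((⟨⟨h1, h2⟩, h3, h4⟩ | ⟨⟨h1, h2⟩, h3, h4⟩) | ⟨⟨h1, h2⟩, h3, h4⟩) | ⟨⟨h1, h2⟩, h3, h4⟩) <;>
        refine ⟨⟨?_, ?_⟩, ?_, ?_⟩ <;> linarith
  rw [e, lintegral_union (lt_meas_Q _ _ _), lintegral_union (lt_meas_Q _ _ _), lintegral_union (lt_meas_Q _ _ _)]
  all_goals
    rw [Set.disjoint_left]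
    simp only [ltQ, Set.mem_union, Set.mem_ofPred_eq, Set.mem_Ico]
  · rintro x ⟨⟨h1, h2⟩, h3, h4⟩ ⟨⟨h1', h2'⟩, h3', h4'⟩; linarith
  · rintro x (⟨⟨h1, h2⟩, h3, h4⟩ | ⟨⟨h1, h2⟩, h3, h4⟩) ⟨⟨h1', h2'⟩, h3', h4'⟩ <;> linarith
  · rintro x ((⟨⟨h1, h2⟩, h3, h4⟩ | ⟨⟨h1, h2⟩, h3, h4⟩) | ⟨⟨h1, h2⟩, h3, h4⟩) ⟨⟨h1', h2'⟩, h3', h4'⟩ <;> linarith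

/-- Pure arithmetic of the combination step. -/
lemma lt_comb (e S1 S2 S3 S4 K1 K2 K3 K4 P1 P2 P3 P4 : ENNReal) (he : e ≠ ⊤)
    (h1 : S1 ≤ K1 + e ∨ S1 + 4 * e ≤ K1 + P1) (h2 : S2 ≤ K2 + e ∨ S2 + 4 * e ≤ K2 + P2)
    (h3 : S3 ≤ K3 + e ∨ S3 + 4 * e ≤ K3 + P3) (h4 : S4 ≤ K4 + e ∨ S4 + 4 * e ≤ K4 + P4)
    (hP : 5 * e ≤ P1 + P2 + P3 + P4) :
    S1 + S2 + S3 + S4 + e ≤ (K1 + K2 + K3 + K4) + (P1 + P2 + P3 + P4) := by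
  have h3e : 3 * e ≠ ⊤ := ENNReal.mul_ne_top (by norm_num) he
  have weak : ∀ S K P : ENNReal, (S ≤ K + e ∨ S + 4 * e ≤ K + P) → S ≤ K + P + e := by
    rintro S K P (h | h)
    · refine h.trans ?_
      rw [add_right_comm]; exact le_self_add
    · exact (le_self_add.trans h).trans le_self_add
  have w1 := weak _ _ _ h1
  have w2 := weak _ _ _ h2
  have w3 := weak _ _ _ h3
  have w4 := weak _ _ _ h4
  rcases h1 with h1 | h1
  swap
  · rw [← ENNReal.add_le_add_iff_right h3e]
    calc _ = (S1 + 4 * e) + S2 + S3 + S4 := by ring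
      _ ≤ (K1 + P1) + (K2 + P2 + e) + (K3 + P3 + e) + (K4 + P4 + e) := by gcongr
      _ = _ := by ring
  rcases h2 with h2 | h2
  swap
  · rw [← ENNReal.add_le_add_iff_right h3e]
    calc _ = S1 + (S2 + 4 * e) + S3 + S4 := by ring
      _ ≤ (K1 + P1 + e) + (K2 + P2) + (K3 + P3 + e) + (K4 + P4 + e) := by gcongr
      _ = _ := by ring
  rcases h3 with h3 | h3
  swap
  · rw [← ENNReal.add_le_add_iff_right h3e]
    calc _ = S1 + S2 + (S3 + 4 * e) + S4 := by ring
      _ ≤ (K1 + P1 + e) + (K2 + P2 + e) + (K3 + P3) + (K4 + P4 + e) := by gcongr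
      _ = _ := by ring
  rcases h4 with h4 | h4
  swap
  · rw [← ENNReal.add_le_add_iff_right h3e]
    calc _ = S1 + S2 + S3 + (S4 + 4 * e) := by ring
      _ ≤ (K1 + P1 + e) + (K2 + P2 + e) + (K3 + P3 + e) + (K4 + P4) := by gcongr
      _ = _ := by ring
  calc _ ≤ (K1 + e) + (K2 + e) + (K3 + e) + (K4 + e) + e := by gcongr
    _ = (K1 + K2 + K3 + K4) + 5 * e := by ring
    _ ≤ _ := by gcongr

lemma lt_induct (r t φ : E2 → ENNReal)
  (hlady : ∀ a b L : ℝ, 0 < L → ∫⁻ x in ltQ a b L, r x ≤ 3 →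
    ∫⁻ x in ltQ a b L, r x ^ 2 ≤ 24 * (∫⁻ x in ltQ a b L, t x) + ENNReal.ofReal (18 / L ^ 2))
  (hexcl : ∀ a b L : ℝ, 0 < L → ENNReal.ofReal (2 / (9 * L ^ 2)) * (∫⁻ x in ltQ a b L, r x)
      ≤ (∫⁻ x in ltQ a b L, φ x) + ENNReal.ofReal (2 / (9 * L ^ 2)) * 2)
  (n : ℕ) : ∀ (a b L : ℝ), 0 < L → (∀ a' b', ∫⁻ x in ltQ a' b' (L / 2 ^ n), r x ≤ 3) →
    3 < ∫⁻ x in ltQ a b L, r x →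
    (∫⁻ x in ltQ a b L, r x ^ 2) + ENNReal.ofReal (72 / L ^ 2) ≤
      24 * (∫⁻ x in ltQ a b L, t x) + 1620 * ∫⁻ x in ltQ a b L, φ x := by
  induction n with
  | zero =>
    intro a b L hL h h3
    have := h a b
    simp only [pow_zero, div_one] at this
    exact absurd this (not_le.2 h3)
  | succ n ih =>
    intro a b L hL h h3
    have hP : 5 * ENNReal.ofReal (72 / L ^ 2) ≤ 1620 * ∫⁻ x in ltQ a b L, φ x := by
      have h1 := hexcl a b L hL
      set c := ENNReal.ofReal (2 / (9 * L ^ 2)) with hc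
      have h2 : c + c * 2 ≤ (∫⁻ x in ltQ a b L, φ x) + c * 2 := by
        refine le_trans ?_ h1
        calc c + c * 2 = c * 3 := by ring
          _ ≤ _ := mul_le_mul_right h3.le _
      have h4 : c ≤ ∫⁻ x in ltQ a b L, φ x :=
        (ENNReal.add_le_add_iff_right (ENNReal.mul_ne_top ENNReal.ofReal_ne_top (by norm_num))).1 h2
      calc 5 * ENNReal.ofReal (72 / L ^ 2) = 1620 * c := by
            rw [hc, show (5 : ENNReal) = ENNReal.ofReal 5 by norm_num, show (1620 : ENNReal) = ENNReal.ofReal 1620 by norm_num,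
              ← ENNReal.ofReal_mul (by norm_num), ← ENNReal.ofReal_mul (by norm_num)]
            congr 1; field_simp; norm_num
        _ ≤ _ := mul_le_mul_right h4 _
    have child : ∀ a' b', ∫⁻ x in ltQ a' b' (L / 2), r x ^ 2 ≤ 24 * (∫⁻ x in ltQ a' b' (L / 2), t x) + ENNReal.ofReal (72 / L ^ 2)
        ∨ (∫⁻ x in ltQ a' b' (L / 2), r x ^ 2) + 4 * ENNReal.ofReal (72 / L ^ 2) ≤
          24 * (∫⁻ x in ltQ a' b' (L / 2), t x) + 1620 * ∫⁻ x in ltQ a' b' (L / 2), φ x := by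
      intro a' b'
      rcases le_or_gt (∫⁻ x in ltQ a' b' (L / 2), r x) 3 with hc | hc
      · left
        have := hlady a' b' (L / 2) (by positivity) hc
        rwa [show 18 / (L / 2) ^ 2 = 72 / L ^ 2 by field_simp; norm_num] at this
      · right
        have := ih a' b' (L / 2) (by positivity) (by
          intro a'' b''
          rw [div_div, ← pow_succ']
          exact h a'' b'') hc
        rwa [show ENNReal.ofReal (72 / (L / 2) ^ 2) = 4 * ENNReal.ofReal (72 / L ^ 2) by
          rw [show (4 : ENNReal) = ENNReal.ofReal 4 by norm_num, ← ENNReal.ofReal_mul (by norm_num)]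
          congr 1; field_simp; norm_num] at this
    rw [lt_Q_split a b L hL φ, mul_add, mul_add, mul_add] at hP ⊢
    rw [lt_Q_split a b L hL t, lt_Q_split a b L hL (fun x => r x ^ 2), mul_add, mul_add, mul_add]
    exact lt_comb _ _ _ _ _ _ _ _ _ _ _ _ _ ENNReal.ofReal_ne_top (child _ _) (child _ _) (child _ _) (child _ _) hP

lemma lt_big (r t φ : E2 → ENNReal)
  (hlady : ∀ a b L : ℝ, 0 < L → ∫⁻ x in ltQ a b L, r x ≤ 3 →
    ∫⁻ x in ltQ a b L, r x ^ 2 ≤ 24 * (∫⁻ x in ltQ a b L, t x) + ENNReal.ofReal (18 / L ^ 2))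
  (hexcl : ∀ a b L : ℝ, 0 < L → ENNReal.ofReal (2 / (9 * L ^ 2)) * (∫⁻ x in ltQ a b L, r x)
      ≤ (∫⁻ x in ltQ a b L, φ x) + ENNReal.ofReal (2 / (9 * L ^ 2)) * 2)
  (hr : ∫⁻ x, r x ≠ ⊤) (a b L : ℝ) (hL : 0 < L) :
    ∫⁻ x in ltQ a b L, r x ^ 2 ≤ 24 * (∫⁻ x, t x) + 1620 * (∫⁻ x, φ x) + ENNReal.ofReal (18 / L ^ 2) := by
  obtain ⟨δ, hδ, hδ'⟩ := exists_pos_setLIntegral_lt_of_measure_lt hr (ε := 3) (by norm_num)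
  have hlim : Filter.Tendsto (fun n : ℕ => ENNReal.ofReal (L / 2 ^ n) * ENNReal.ofReal (L / 2 ^ n)) Filter.atTop (nhds 0) := by
    have h1 : Filter.Tendsto (fun n : ℕ => L / 2 ^ n) Filter.atTop (nhds 0) := by
      have := (tendsto_pow_atTop_nhds_zero_of_lt_one (r := (1 / 2 : ℝ)) (by norm_num) (by norm_num)).const_mul L
      simpa [div_eq_mul_inv] using this
    have h2 := ENNReal.tendsto_ofReal (h1.mul h1)
    simp only [mul_zero, ENNReal.ofReal_zero] at h2
    refine h2.congr fun n => ?_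
    rw [ENNReal.ofReal_mul (by positivity)]
  obtain ⟨n, hn⟩ := (hlim.eventually (gt_mem_nhds hδ)).exists
  have hsmall : ∀ a' b', ∫⁻ x in ltQ a' b' (L / 2 ^ n), r x ≤ 3 := fun a' b' =>
    (hδ' _ (by rw [lt_Q_vol]; exact hn)).le
  have ht : ∫⁻ x in ltQ a b L, t x ≤ ∫⁻ x, t x := setLIntegral_le_lintegral _ _
  have hp : ∫⁻ x in ltQ a b L, φ x ≤ ∫⁻ x, φ x := setLIntegral_le_lintegral _ _
  rcases le_or_gt (∫⁻ x in ltQ a b L, r x) 3 with hc | hc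
  · refine (hlady a b L hL hc).trans ?_
    gcongr
    exact (mul_le_mul_right ht _).trans le_self_add
  · refine (le_self_add.trans (lt_induct r t φ hlady hexcl n a b L hL hsmall hc)).trans ?_
    refine le_trans ?_ le_self_add
    gcongr

lemma lt_multi (r t φ : E2 → ENNReal)
  (hlady : ∀ a b L : ℝ, 0 < L → ∫⁻ x in ltQ a b L, r x ≤ 3 →
    ∫⁻ x in ltQ a b L, r x ^ 2 ≤ 24 * (∫⁻ x in ltQ a b L, t x) + ENNReal.ofReal (18 / L ^ 2))
  (hexcl : ∀ a b L : ℝ, 0 < L → ENNReal.ofReal (2 / (9 * L ^ 2)) * (∫⁻ x in ltQ a b L, r x)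
      ≤ (∫⁻ x in ltQ a b L, φ x) + ENNReal.ofReal (2 / (9 * L ^ 2)) * 2)
  (hr : ∫⁻ x, r x ≠ ⊤) :
    ∫⁻ x, r x ^ 2 ≤ 24 * (∫⁻ x, t x) + 1620 * (∫⁻ x, φ x) := by
  let Q : ℕ → Set E2 := fun n => ltQ (-(n + 1 : ℝ)) (-(n + 1 : ℝ)) (2 * (n + 1))
  have hmono : Monotone Q := by
    intro n m h x hx
    obtain ⟨⟨h1, h2⟩, h3, h4⟩ := hx
    have : (n : ℝ) ≤ m := by exact_mod_cast h
    refine ⟨⟨?_, ?_⟩, ?_, ?_⟩ <;> linarith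
  have hun : ⋃ n, Q n = Set.univ := by
    rw [Set.eq_univ_iff_forall]
    intro x
    obtain ⟨n, hn⟩ := exists_nat_gt (max |x 0| |x 1|)
    rw [max_lt_iff, abs_lt, abs_lt] at hn
    refine Set.mem_iUnion.2 ⟨n, ⟨?_, ?_⟩, ?_, ?_⟩ <;> linarith [hn.1.1, hn.1.2, hn.2.1, hn.2.2]
  have h1 : Filter.Tendsto (fun n => ∫⁻ x in Q n, r x ^ 2) Filter.atTop (nhds (∫⁻ x, r x ^ 2)) := by
    have := tendsto_measure_iUnion_atTop (μ := volume.withDensity (fun x => r x ^ 2)) hmono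
    rw [hun, withDensity_apply _ MeasurableSet.univ, Measure.restrict_univ] at this
    refine this.congr fun n => ?_
    exact withDensity_apply _ (lt_meas_Q _ _ _)
  have h2 : Filter.Tendsto (fun n : ℕ => 24 * (∫⁻ x, t x) + 1620 * (∫⁻ x, φ x) + ENNReal.ofReal (18 / (2 * (n + 1 : ℝ)) ^ 2))
      Filter.atTop (nhds (24 * (∫⁻ x, t x) + 1620 * (∫⁻ x, φ x) + ENNReal.ofReal 0)) := by
    refine Filter.Tendsto.add tendsto_const_nhds (ENNReal.tendsto_ofReal ?_)
    have h3 := tendsto_one_div_add_atTop_nhds_zero_nat (𝕜 := ℝ)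
    have h4 := (h3.pow 2).const_mul (18 / 4)
    simp only [ne_eq, OfNat.ofNat_ne_zero, not_false_eq_true, zero_pow, mul_zero] at h4
    refine h4.congr fun n => ?_
    field_simp
    norm_num
  rw [ENNReal.ofReal_zero, add_zero] at h2
  exact le_of_tendsto_of_tendsto' h1 h2 fun n =>
    lt_big r t φ hlady hexcl hr _ _ _ (by positivity)

lemma lt_ofReal_int {β : Type*} [MeasurableSpace β] (μ : Measure β) (f : β → ℝ) (hf : ∀ x, 0 ≤ f x) :
    ENNReal.ofReal (∫ x, f x ∂μ) ≤ ∫⁻ x, ENNReal.ofReal (f x) ∂μ := by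
  by_cases h : Integrable f μ
  · rw [ofReal_integral_eq_lintegral_ofReal h (Filter.Eventually.of_forall hf)]
  · rw [integral_undef h]; simp

lemma lt_Avec_abs {N : ℕ} (X : Fin N → E2) (j : Fin N) (c : Fin 2) :
    |AvecIdeal X j c| ≤ ∑ k ∈ Finset.univ.erase j, ‖X j - X k‖⁻¹ := by
  have key : ∀ v : E2, ∀ i, (‖v‖ ^ 2)⁻¹ * |v i| ≤ ‖v‖⁻¹ := by
    intro v i
    have h1 : |v i| ≤ ‖v‖ := PiLp.norm_apply_le v i
    by_cases hv : ‖v‖ = 0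
    · rw [hv]; simp
    · calc (‖v‖ ^ 2)⁻¹ * |v i| ≤ (‖v‖ ^ 2)⁻¹ * ‖v‖ := by gcongr
        _ = _ := by field_simp
  fin_cases c
  · simp only [Fin.zero_eta, lt_Avec_zero]
    refine (Finset.abs_sum_le_sum_abs _ _).trans (Finset.sum_le_sum fun k _ => ?_)
    rw [abs_mul, abs_neg, abs_of_nonneg (by positivity : 0 ≤ (‖X j - X k‖ ^ 2)⁻¹)]
    exact key _ 1
  · simp only [Fin.mk_one, lt_Avec_one]
    refine (Finset.abs_sum_le_sum_abs _ _).trans (Finset.sum_le_sum fun k _ => ?_)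
    rw [abs_mul, abs_of_nonneg (by positivity : 0 ≤ (‖X j - X k‖ ^ 2)⁻¹)]
    exact key _ 0

lemma lt_T_integrable {N : ℕ} (α : ℝ) (Ψ : (Fin N → E2) → ℂ) (hΨ : ContDiff ℝ 1 Ψ) (hs : HasCompactSupport Ψ)
    (hdiag : ∀ X : Fin N → E2, (∃ j k, j ≠ k ∧ X j = X k) → Ψ X = 0) (j : Fin N) :
    Integrable (ltT α Ψ j) := by
  classical
  obtain ⟨C, hC⟩ := hΨ.lipschitzWith_of_hasCompactSupport hs (by norm_num)
  have hb1 : ∀ X c, ‖fderiv ℝ Ψ X (dirv N j c)‖ ≤ C * ‖dirv N j c‖ := fun X c =>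
    (ContinuousLinearMap.le_opNorm _ _).trans (by gcongr; exact norm_fderiv_le_of_lipschitz ℝ hC)
  have hb2 : ∀ X k, k ≠ j → ‖X j - X k‖⁻¹ * ‖Ψ X‖ ≤ C := by
    intro X k hk
    have h0 : Ψ (Function.update X j (X k)) = 0 :=
      hdiag _ ⟨j, k, hk.symm, by simp [Function.update_of_ne hk]⟩
    have h1 : ‖Ψ X‖ ≤ C * ‖X j - X k‖ := by
      have := hC.norm_sub_le X (Function.update X j (X k))
      rw [h0, sub_zero] at this
      refine this.trans ?_
      gcongr
      rw [pi_norm_le_iff_of_nonneg (norm_nonneg _)]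
      intro l
      by_cases hl : l = j
      · subst hl; simp
      · simp [Function.update_of_ne hl]
    by_cases hv : ‖X j - X k‖ = 0
    · rw [hv]; simp
    · have : 0 < ‖X j - X k‖ := lt_of_le_of_ne (norm_nonneg _) (Ne.symm hv)
      rw [inv_mul_le_iff₀ this]; linarith
  have hb3 : ∀ X c, ‖covDIdeal α Ψ j X c‖ ≤ C * ‖dirv N j c‖ + |α| * (N * C) := by
    intro X c
    unfold covDIdeal
    refine (norm_add_le _ _).trans (add_le_add ?_ ?_)
    · rw [norm_mul, norm_neg, Complex.norm_I, one_mul]; exact hb1 X c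
    · rw [norm_mul, Complex.norm_real, Real.norm_eq_abs, abs_mul, mul_assoc]
      refine mul_le_mul_of_nonneg_left ?_ (abs_nonneg α)
      calc |AvecIdeal X j c| * ‖Ψ X‖ ≤ (∑ k ∈ Finset.univ.erase j, ‖X j - X k‖⁻¹) * ‖Ψ X‖ := by
            gcongr; exact lt_Avec_abs X j c
        _ = ∑ k ∈ Finset.univ.erase j, ‖X j - X k‖⁻¹ * ‖Ψ X‖ := Finset.sum_mul _ _ _
        _ ≤ ∑ k ∈ Finset.univ.erase j, (C : ℝ) := Finset.sum_le_sum fun k hk => hb2 X k (Finset.ne_of_mem_erase hk)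
        _ ≤ ∑ k : Fin N, (C : ℝ) := Finset.sum_le_sum_of_subset_of_nonneg (Finset.subset_univ _) (fun _ _ _ => C.2)
        _ = _ := by simp
  have hsupp : Function.support (ltT α Ψ j) ⊆ tsupport Ψ := by
    intro X hX
    by_contra hn
    apply hX
    have h1 : Ψ X = 0 := image_eq_zero_of_notMem_tsupport hn
    have h2 : fderiv ℝ Ψ X = 0 := by
      by_contra h
      exact hn (support_fderiv_subset ℝ (Function.mem_support.2 h))
    simp [ltT, covDIdeal, h1, h2]
  rw [← integrableOn_iff_integrable_of_support_subset hsupp]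
  refine Measure.integrableOn_of_bounded (M := ∑ c : Fin 2, (C * ‖dirv N j c‖ + |α| * (N * C)) ^ 2)
    hs.isCompact.measure_lt_top.ne (lt_meas_T α Ψ hΨ j).aestronglyMeasurable ?_
  refine Filter.Eventually.of_forall fun X => ?_
  rw [Real.norm_eq_abs, abs_of_nonneg (lt_T_nonneg α Ψ j X)]
  unfold ltT
  refine Finset.sum_le_sum fun c _ => ?_
  have := hb3 X c
  gcongr

lemma lt_R_int {N : ℕ} (f : Fin N → (Fin N → E2) → ENNReal) (hf : ∀ j, Measurable (f j)) :
    ∫⁻ x, ltR f x = ∑ j, ∫⁻ X, f j X := by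
  have := lt_M_eq f hf Set.univ MeasurableSet.univ
  rw [Measure.restrict_univ] at this
  rw [← this]
  unfold ltM
  simp

lemma lt_main_lint {N : ℕ} (α : ℝ) (hα : α ∈ Set.Icc (0 : ℝ) 2) (hα1 : α ≠ 1) (Ψ : (Fin N → E2) → ℂ) (hΨ : ContDiff ℝ 1 Ψ)
    (hanti : Antisym N Ψ) (hdiag : ∀ X : Fin N → E2, (∃ j k, j ≠ k ∧ X j = X k) → Ψ X = 0)
    (hnorm : ∫⁻ X, ENNReal.ofReal (‖Ψ X‖ ^ 2) = 1) :
    ∫⁻ x, ltR (ltu Ψ) x ^ 2 ≤ ENNReal.ofReal (437424 / |1 - α|) * ∑ j, ∫⁻ X, ENNReal.ofReal (ltT α Ψ j X) := by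
  have hT : ∀ j, Measurable (fun X => ENNReal.ofReal (ltT α Ψ j X)) := fun j =>
    ENNReal.measurable_ofReal.comp (lt_meas_T α Ψ hΨ j)
  have hF : ∀ j, Measurable (fun X => ∑ k, ltF Ψ j k X) := fun j => Finset.measurable_sum _ (fun k _ => lt_meas_F Ψ hΨ j k)
  have hν : 0 < |1 - α| := abs_pos.2 (sub_ne_zero.2 (Ne.symm hα1))
  have hν1 : |1 - α| ≤ 1 := abs_le.2 ⟨by linarith [hα.2], by linarith [hα.1]⟩
  have h := lt_multi (ltR (ltu Ψ)) (ltR (fun j X => ENNReal.ofReal (ltT α Ψ j X))) (ltR (fun j X => ∑ k, ltF Ψ j k X))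
    (fun a b L hL hm => by
      have := lt_lady2 α Ψ hΨ a b L hL (by rwa [lt_M_eq _ (lt_meas_u Ψ hΨ) _ (lt_meas_Q a b L)])
      rwa [lt_M_eq _ hT _ (lt_meas_Q a b L)] at this)
    (fun a b L hL => by
      have := lt_excl Ψ hΨ hdiag hnorm a b L hL
      rw [lt_M_eq _ hF _ (lt_meas_Q a b L)] at this
      rw [← lt_M_eq _ (lt_meas_u Ψ hΨ) _ (lt_meas_Q a b L)]
      exact this)
    (by
      rw [lt_R_int _ (lt_meas_u Ψ hΨ)]
      unfold ltu
      rw [hnorm, Finset.sum_const, nsmul_eq_mul, mul_one]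
      exact ENNReal.natCast_ne_top _)
  rw [lt_R_int _ hT, lt_R_int _ hF] at h
  set T := ∑ j, ∫⁻ X, ENNReal.ofReal (ltT α Ψ j X)
  have hW := lt_W α hα hα1 Ψ hΨ hanti
  calc _ ≤ _ := h
    _ ≤ 24 * T + 1620 * (ENNReal.ofReal (30 / |1 - α|) * (9 * T)) := by gcongr
    _ = ENNReal.ofReal (24 + 1620 * (30 / |1 - α|) * 9) * T := by
        rw [ENNReal.ofReal_add (by norm_num) (by positivity), ENNReal.ofReal_mul (by positivity), ENNReal.ofReal_mul (by positivity)]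
        norm_num
        ring
    _ ≤ _ := by
        gcongr
        rw [div_eq_mul_inv, div_eq_mul_inv]
        have : 1 ≤ |1 - α|⁻¹ := (one_le_inv₀ hν).2 hν1
        linarith

lemma lt_density_le {N : ℕ} (Ψ : (Fin N → E2) → ℂ) (x : E2) : ENNReal.ofReal (density N Ψ x) ≤ ltR (ltu Ψ) x := by
  unfold density ltR
  rw [ENNReal.ofReal_sum_of_nonneg (fun j _ => integral_nonneg fun Y => by positivity)]
  refine Finset.sum_le_sum fun j _ => ?_
  exact lt_ofReal_int _ _ (fun Y => by positivity)

/-- **Lieb–Thirring inequality for ideal anyons.** -/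
theorem lieb_thirring_ideal_anyons :
    ∃ C : ℝ, 0 < C ∧
      ∀ α : ℝ, α ∈ Set.Icc (0 : ℝ) 2 →
        ∀ N : ℕ, 1 ≤ N →
          ∀ Ψ : (Fin N → E2) → ℂ,
            ContDiff ℝ (⊤ : ℕ∞) Ψ → HasCompactSupport Ψ → Antisym N Ψ →
            (∀ X : Fin N → E2, (∃ j k, j ≠ k ∧ X j = X k) → Ψ X = 0) →
            (∫ X : Fin N → E2, ‖Ψ X‖ ^ 2) = 1 →
            C * |1 - α| * (∫ x : E2, density N Ψ x ^ 2)
              ≤ ∑ j : Fin N, ∫ X : Fin N → E2, ∑ c : Fin 2, ‖covDIdeal α Ψ j X c‖ ^ 2 := by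
  refine ⟨1 / 437424, by norm_num, fun α hα N _ Ψ hΨ0 hs hanti hdiag hn => ?_⟩
  have hΨ : ContDiff ℝ 1 Ψ := hΨ0.of_le (by exact_mod_cast le_top)
  have hR0 : 0 ≤ ∑ j : Fin N, ∫ X : Fin N → E2, ∑ c : Fin 2, ‖covDIdeal α Ψ j X c‖ ^ 2 :=
    Finset.sum_nonneg fun j _ => integral_nonneg fun X => lt_T_nonneg α Ψ j X
  by_cases hα1 : α = 1
  · have h0 : |1 - α| = 0 := by rw [hα1]; simp
    rw [h0, mul_zero, zero_mul]
    exact hR0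
  have hν : 0 < |1 - α| := abs_pos.2 (sub_ne_zero.2 (Ne.symm hα1))
  have hIntg : Integrable (fun X => ‖Ψ X‖ ^ 2) := by
    by_contra h
    rw [integral_undef h] at hn
    exact zero_ne_one hn
  have hnorm : ∫⁻ X, ENNReal.ofReal (‖Ψ X‖ ^ 2) = 1 := by
    rw [← ofReal_integral_eq_lintegral_ofReal hIntg (Filter.Eventually.of_forall fun X => by positivity), hn, ENNReal.ofReal_one]
  have hmain := lt_main_lint α hα hα1 Ψ hΨ hanti hdiag hnorm
  have hT : ∑ j, ∫⁻ X, ENNReal.ofReal (ltT α Ψ j X)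
      = ENNReal.ofReal (∑ j : Fin N, ∫ X : Fin N → E2, ∑ c : Fin 2, ‖covDIdeal α Ψ j X c‖ ^ 2) := by
    change _ = ENNReal.ofReal (∑ j : Fin N, ∫ X : Fin N → E2, ltT α Ψ j X)
    rw [ENNReal.ofReal_sum_of_nonneg (fun j _ => integral_nonneg fun X => lt_T_nonneg α Ψ j X)]
    refine Finset.sum_congr rfl fun j _ => ?_
    exact (ofReal_integral_eq_lintegral_ofReal (lt_T_integrable α Ψ hΨ hs hdiag j)
      (Filter.Eventually.of_forall fun X => lt_T_nonneg α Ψ j X)).symm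
  have hρ : ENNReal.ofReal (∫ x : E2, density N Ψ x ^ 2) ≤ ∫⁻ x, ltR (ltu Ψ) x ^ 2 := by
    refine (lt_ofReal_int _ _ (fun x => by positivity)).trans (lintegral_mono fun x => ?_)
    have h0 : 0 ≤ density N Ψ x := Finset.sum_nonneg fun j _ => integral_nonneg fun Y => by positivity
    rw [ENNReal.ofReal_pow h0]
    gcongr
    exact lt_density_le Ψ x
  have hfin := hρ.trans hmain
  rw [hT, ← ENNReal.ofReal_mul (by positivity), ENNReal.ofReal_le_ofReal_iff (by positivity)] at hfin
  calc _ ≤ 1 / 437424 * |1 - α| * (437424 / |1 - α| * ∑ j : Fin N, ∫ X : Fin N → E2, ∑ c : Fin 2, ‖covDIdeal α Ψ j X c‖ ^ 2) := by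
        gcongr
    _ = _ := by field_simp
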